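/- arXiv:1706.04462 — 2 statements merged into one kernel-verified Lean document; each statement's English description precedes it below -/
import Mathlib

section
/- Let $N\geq 2$, $1\leq d<N$, $0<p<q\leq\infty$, $s>\sigma_p := N(1/p-1)_+$, and let $\Psi$ be an admissible function with $\sum_{j\geq 0}\Psi(2^{-j})^{\chi} = \infty$ for $\chi = qp/(q-p)$ (resp. $\chi = p$ if $q=\infty$). If $q<\infty$ and $\Psi$ is increasing, assume additionally $\chi < 1/c_\infty$ where $c_\infty := \sup_{0<t\leq 1}\log_2(\Psi(t)/\Psi(t^2))$. Then there exists $f \in B^s_{p,q}(\mathbb{R}^N)$ such that $f(\cdot,y) \notin B^{(s,\Psi)}_{p,q}(\mathbb{R}^d)$ for almost every $y\in\mathbb{R}^{N-d}$. -/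
open MeasureTheory
open scoped ENNReal

noncomputable section

/-- The `M`-th iterated difference operator `Δ_h^M f`. -/
def iterDiff {E : Type*} [AddCommGroup E] [Module ℝ E] (M : ℕ) (f : E → ℝ) (h : E) :
    E → ℝ :=
  fun x => ∑ i ∈ Finset.range (M + 1), (-1 : ℝ) ^ (M - i) * (M.choose i) * f (x + (i : ℝ) • h)

/-- `σ_p = N (1/p - 1)_+`. -/
def sigmaP (n : ℕ) (p : ℝ≥0∞) : ℝ := n * max (1 / p.toReal - 1) 0

/-- The Besov quasi-norm on `ℝ^n`, defined via `M = ⌊s⌋ + 1` iterated differences: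
`‖f‖_{L^p} + (∫_{|h|≤1} ‖Δ_h^M f‖_{L^p}^q |h|^{-n-sq} dh)^{1/q}`
(usual modification if `q = ∞`). -/
def besovNorm (n : ℕ) (p q : ℝ≥0∞) (s : ℝ) (f : (Fin n → ℝ) → ℝ) : ℝ≥0∞ :=
  eLpNorm f p volume +
    (if q = ⊤ then
      ⨆ (h : Fin n → ℝ) (_ : ‖h‖ ≤ 1),
        eLpNorm (iterDiff (⌊s⌋₊ + 1) f h) p volume * ENNReal.ofReal (‖h‖ ^ (-s))
    else
      (∫⁻ h in {h : Fin n → ℝ | ‖h‖ ≤ 1},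
          eLpNorm (iterDiff (⌊s⌋₊ + 1) f h) p volume ^ q.toReal *
            ENNReal.ofReal (‖h‖ ^ (-(n : ℝ) - s * q.toReal))) ^ (1 / q.toReal))

/-- Membership in the Besov space `B^s_{p,q}(ℝ^n)`. -/
def MemBesov (n : ℕ) (p q : ℝ≥0∞) (s : ℝ) (f : (Fin n → ℝ) → ℝ) : Prop :=
  AEStronglyMeasurable f volume ∧ besovNorm n p q s f < ⊤

/-- The restriction `f(·, y)` of `f : ℝ^N → ℝ` to the `d`-plane with last `N - d`
coordinates equal to `y`. -/
def restrictLast (N d : ℕ) (f : (Fin N → ℝ) → ℝ) (y : Fin (N - d) → ℝ) :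
    (Fin d → ℝ) → ℝ :=
  fun x => f fun i =>
    if h : (i : ℕ) < d then x ⟨i, h⟩ else y ⟨(i : ℕ) - d, by have := i.isLt; omega⟩

end

/-- A positive function on `(0,1]` is *admissible* if it is monotone and satisfies
`Ψ(2^{-j}) ∼ Ψ(2^{-2j})` uniformly in `j ∈ ℕ`. -/
def Admissible (Ψ : ℝ → ℝ) : Prop :=
  (∀ t ∈ Set.Ioc (0 : ℝ) 1, 0 < Ψ t) ∧
    (MonotoneOn Ψ (Set.Ioc (0 : ℝ) 1) ∨ AntitoneOn Ψ (Set.Ioc (0 : ℝ) 1)) ∧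
    ∃ c C : ℝ, 0 < c ∧
      ∀ j : ℕ, c * Ψ ((2 : ℝ) ^ (-(2 * j : ℝ))) ≤ Ψ ((2 : ℝ) ^ (-(j : ℝ))) ∧
        Ψ ((2 : ℝ) ^ (-(j : ℝ))) ≤ C * Ψ ((2 : ℝ) ^ (-(2 * j : ℝ)))

/-- The exponent `χ = qp/(q-p)` (resp. `χ = p` if `q = ∞`). -/
noncomputable def chiExp (p : ℝ≥0∞) (q : ℝ≥0∞) : ℝ :=
  if q = ⊤ then p.toReal else q.toReal * p.toReal / (q.toReal - p.toReal)

noncomputable section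

/-- The quasi-norm of the Besov space of generalized smoothness `B^{(s,Ψ)}_{p,q}(ℝ^n)`,
defined with `M = ⌊s⌋ + 1` iterated differences as
`‖f‖_{L^p} + (∫_0^1 sup_{|h|≤t} ‖Δ_h^M f‖_{L^p}^q Ψ(t)^q t^{-1-sq} dt)^{1/q}`
(usual modification if `q = ∞`). -/
def genBesovNorm (n : ℕ) (p q : ℝ≥0∞) (s : ℝ) (Ψ : ℝ → ℝ) (f : (Fin n → ℝ) → ℝ) : ℝ≥0∞ :=
  eLpNorm f p volume +
    (if q = ⊤ then
      ⨆ (t : ℝ) (_ : t ∈ Set.Ioc (0 : ℝ) 1),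
        (⨆ (h : Fin n → ℝ) (_ : ‖h‖ ≤ t), eLpNorm (iterDiff (⌊s⌋₊ + 1) f h) p volume) *
          ENNReal.ofReal (Ψ t * t ^ (-s))
    else
      (∫⁻ t in Set.Ioc (0 : ℝ) 1,
          (⨆ (h : Fin n → ℝ) (_ : ‖h‖ ≤ t), eLpNorm (iterDiff (⌊s⌋₊ + 1) f h) p volume) ^
              q.toReal *
            ENNReal.ofReal (Ψ t ^ q.toReal * t ^ (-1 - s * q.toReal))) ^ (1 / q.toReal))

/-- Membership in the Besov space of generalized smoothness `B^{(s,Ψ)}_{p,q}(ℝ^n)`. -/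
def MemGenBesov (n : ℕ) (p q : ℝ≥0∞) (s : ℝ) (Ψ : ℝ → ℝ) (f : (Fin n → ℝ) → ℝ) : Prop :=
  AEStronglyMeasurable f volume ∧ genBesovNorm n p q s Ψ f < ⊤

end


open Filter Topology
open scoped ContDiff

theorem iterDiff_eq_fwd {E : Type*} [AddCommGroup E] [Module ℝ E] (M : ℕ) (f : E → ℝ) (h x : E) :
    iterDiff M f h x = (fwdDiff h)^[M] f x := by
  rw [fwdDiff_iter_eq_sum_shift, iterDiff]
  refine Finset.sum_congr rfl fun i _ => ?_
  rw [zsmul_eq_mul, Nat.cast_smul_eq_nsmul]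
  push_cast
  ring

theorem fderiv_fwdDiff_iter {E : Type} [NormedAddCommGroup E] [NormedSpace ℝ E] (M : ℕ) (h : E) :
    ∀ {G : Type} [NormedAddCommGroup G] [NormedSpace ℝ G] (F : E → G), Differentiable ℝ F →
    ∀ x, HasFDerivAt ((fwdDiff h)^[M] F) ((fwdDiff h)^[M] (fderiv ℝ F) x) x := by
  induction M with
  | zero => intro G _ _ F hF x; exact (hF x).hasFDerivAt
  | succ M ih =>
    intro G _ _ F hF x
    rw [Function.iterate_succ', Function.iterate_succ']
    simp only [Function.comp]
    have h1 := ih F hF x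
    have h2 := ih F hF (x + h)
    have h3 : HasFDerivAt (fun y => (fwdDiff h)^[M] F (y + h))
        ((fwdDiff h)^[M] (fderiv ℝ F) (x + h)) x := by
      exact (hasFDerivAt_comp_add_right h).2 h2
    exact h3.sub h1

theorem fwdDiff_iter_bound {E : Type} [NormedAddCommGroup E] [NormedSpace ℝ E]  (M : ℕ) :
    ∀ {G : Type} [NormedAddCommGroup G] [NormedSpace ℝ G] (F : E → G), ContDiff ℝ ∞ F →
    HasCompactSupport F →
    ∃ C : ℝ, ∀ h x, ‖(fwdDiff h)^[M] F x‖ ≤ C * ‖h‖ ^ M := by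
  induction M with
  | zero =>
    intro G _ _ F hF hc
    obtain ⟨C, hC⟩ := hc.exists_bound_of_continuous hF.continuous
    exact ⟨C, fun h x => by simpa using hC x⟩
  | succ M ih =>
    intro G _ _ F hF hc
    obtain ⟨C, hC⟩ := ih (fderiv ℝ F) (hF.fderiv_right (by simp)) (hc.fderiv ℝ)
    refine ⟨C, fun h x => ?_⟩
    rw [Function.iterate_succ']
    have hd := fderiv_fwdDiff_iter M h F (hF.differentiable (by simp))
    have := Convex.norm_image_sub_le_of_norm_hasFDerivWithin_le (s := Set.univ)
      (fun x _ => (hd x).hasFDerivWithinAt) (fun x _ => hC h x) convex_univ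
      (Set.mem_univ x) (Set.mem_univ (x + h))
    simp only [Function.comp, fwdDiff]
    refine this.trans (le_of_eq ?_)
    rw [add_sub_cancel_left]; ring

theorem fwdDiff_iter_bound' {E : Type} [NormedAddCommGroup E] (M : ℕ) (F : E → ℝ)
    (C : ℝ) (hF : ∀ x, ‖F x‖ ≤ C) (h : E) : ∀ x, ‖(fwdDiff h)^[M] F x‖ ≤ 2 ^ M * C := by
  induction M with
  | zero => simpa using hF
  | succ M ih =>
    intro x
    rw [Function.iterate_succ']
    simp only [Function.comp, fwdDiff]
    refine (norm_sub_le _ _).trans ?_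
    have h1 := ih x
    have h2 := ih (x + h)
    rw [pow_succ]
    linarith

theorem iterDiff_bound {E : Type} [NormedAddCommGroup E] [NormedSpace ℝ E] (M : ℕ) (F : E → ℝ)
    (hF : ContDiff ℝ ∞ F) (hc : HasCompactSupport F) :
    ∃ C : ℝ, 0 ≤ C ∧ ∀ h x, ‖iterDiff M F h x‖ ≤ C * min 1 (‖h‖ ^ M) := by
  obtain ⟨C, hC⟩ := fwdDiff_iter_bound M F hF hc
  obtain ⟨C', hC'⟩ := hc.exists_bound_of_continuous hF.continuous
  have h0 : 0 ≤ max C (2 ^ M * C') := by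
    have := (norm_nonneg _).trans (hC' 0)
    exact le_max_of_le_right (by positivity)
  refine ⟨max C (2 ^ M * C'), h0, fun h x => ?_⟩
  rw [iterDiff_eq_fwd, mul_min_of_nonneg _ _ h0]
  refine le_min ?_ ?_
  · rw [mul_one]; exact (fwdDiff_iter_bound' M F C' hC' h x).trans (le_max_right _ _)
  · exact (hC h x).trans (by gcongr; exact le_max_left _ _)

theorem exists_bump (N : ℕ) : ∃ φ : (Fin N → ℝ) → ℝ, ContDiff ℝ ∞ φ ∧ HasCompactSupport φ ∧
    (∀ z, ‖z‖ ≤ 1 / 4 → φ z = 1) ∧ (∀ z, 1 / 2 ≤ ‖z‖ → φ z = 0) := by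
  let b : ContDiffBump (0 : Fin N → ℝ) := ⟨1/4, 1/2, by norm_num, by norm_num⟩
  refine ⟨b, b.contDiff, b.hasCompactSupport, fun z hz => ?_, fun z hz => ?_⟩
  · exact b.one_of_mem_closedBall (by simpa [b] using hz)
  · exact b.zero_of_le_dist (by simpa [b] using hz)

theorem lintegral_comp_smul_sub {N : ℕ} (c : Fin N → ℝ) (l : ℝ) (hl : 0 < l)
    (F : (Fin N → ℝ) → ℝ≥0∞) :
    ∫⁻ z, F (l • (z - c)) = ENNReal.ofReal ((l ^ N)⁻¹) * ∫⁻ z, F z := by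
  rw [lintegral_sub_right_eq_self (fun z => F (l • z)) c]
  have h1 : MeasurableEmbedding (fun z : Fin N → ℝ => l • z) :=
    (Homeomorph.smulOfNeZero l hl.ne').measurableEmbedding
  rw [← h1.lintegral_map, Measure.map_addHaar_smul _ hl.ne', lintegral_smul_measure]
  rw [Module.finrank_fin_fun, abs_of_pos (by positivity)]
  rfl

theorem iterDiff_comp_smul {N : ℕ} (M : ℕ) (φ : (Fin N → ℝ) → ℝ) (A l : ℝ) (c h z : Fin N → ℝ) :
    iterDiff M (fun z => A * φ (l • (z - c))) h z = A * iterDiff M φ (l • h) (l • (z - c)) := by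
  simp only [iterDiff, Finset.mul_sum]
  refine Finset.sum_congr rfl fun i _ => ?_
  have : l • (z + (i : ℝ) • h - c) = l • (z - c) + (i : ℝ) • l • h := by
    ext k; simp; ring
  rw [this]; ring

/-- `L^p` bound for differences of the bump. -/
theorem lintegral_iterDiff_bump {N : ℕ} (M : ℕ) (φ : (Fin N → ℝ) → ℝ) (hφ : ContDiff ℝ ∞ φ)
    (hc : HasCompactSupport φ) (h0 : ∀ z, 1 / 2 ≤ ‖z‖ → φ z = 0) (P : ℝ) (hP : 0 < P) :
    ∃ C : ℝ≥0∞, C ≠ ⊤ ∧ ∀ h, ∫⁻ z, ‖iterDiff M φ h z‖ₑ ^ P ≤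
      C * ENNReal.ofReal (min 1 (‖h‖ ^ M)) ^ P := by
  obtain ⟨C, hC0, hC⟩ := iterDiff_bound M φ hφ hc
  refine ⟨ENNReal.ofReal C ^ P * ((M + 1 : ℕ) * ENNReal.ofReal 1), ?_, fun h => ?_⟩
  · refine ENNReal.mul_ne_top (ENNReal.rpow_ne_top_of_nonneg hP.le ENNReal.ofReal_ne_top) ?_
    exact ENNReal.mul_ne_top (ENNReal.natCast_ne_top _) ENNReal.ofReal_ne_top
  set U : Set (Fin N → ℝ) := ⋃ i ∈ Finset.range (M + 1),
    Metric.closedBall (-((i : ℝ) • h)) (1 / 2) with hU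
  have hUm : MeasurableSet U := by
    refine Finset.measurableSet_biUnion _ fun i _ => Metric.isClosed_closedBall.measurableSet
  have hUv : volume U ≤ (M + 1 : ℕ) * ENNReal.ofReal 1 := by
    refine (measure_biUnion_finset_le _ _).trans ?_
    refine (Finset.sum_le_sum (g := fun _ => ENNReal.ofReal 1) fun i _ => ?_).trans (by simp)
    rw [Real.volume_pi_closedBall _ (by norm_num)]
    norm_num
  have hpt : ∀ z, ‖iterDiff M φ h z‖ₑ ^ P ≤
      U.indicator (fun _ => (ENNReal.ofReal C * ENNReal.ofReal (min 1 (‖h‖ ^ M))) ^ P) z := by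
    intro z
    by_cases hz : z ∈ U
    · rw [Set.indicator_of_mem hz]
      gcongr
      rw [← ENNReal.ofReal_mul hC0, ← ofReal_norm]
      exact ENNReal.ofReal_le_ofReal (hC h z)
    · rw [Set.indicator_of_notMem hz]
      have : iterDiff M φ h z = 0 := by
        rw [iterDiff]
        refine Finset.sum_eq_zero fun i hi => ?_
        rw [h0, mul_zero]
        by_contra hlt
        apply hz
        rw [hU]
        refine Set.mem_biUnion hi ?_
        rw [Metric.mem_closedBall, dist_eq_norm, sub_neg_eq_add]
        exact (not_le.1 hlt).le
      rw [this]; simp [hP]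
  calc _ ≤ ∫⁻ z, _ := lintegral_mono hpt
    _ = (ENNReal.ofReal C * ENNReal.ofReal (min 1 (‖h‖ ^ M))) ^ P * volume U := by
      rw [lintegral_indicator_const hUm]
    _ ≤ _ := by
      rw [ENNReal.mul_rpow_of_nonneg _ _ hP.le]
      calc _ ≤ ENNReal.ofReal C ^ P * ENNReal.ofReal (min 1 (‖h‖ ^ M)) ^ P *
          ((M + 1 : ℕ) * ENNReal.ofReal 1) := by gcongr
        _ = _ := by ring

/-- Selecting, at each point, one member of the family of functions `G`. -/
noncomputable def glueFn {N : ℕ} (i0 : Fin N) (D : ℝ) (G : ℤ → (Fin N → ℝ) → ℝ) :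
    (Fin N → ℝ) → ℝ := fun z => G (round (z i0 / D)) z

theorem glueFn_local {N : ℕ} (i0 : Fin N) (D : ℝ) (hD : 2 ≤ D) (G : ℤ → (Fin N → ℝ) → ℝ)
    (hG : ∀ (e : ℤ) (z : Fin N → ℝ), 1 / 2 ≤ |z i0 - D * e| → G e z = 0) (e : ℤ) (z : Fin N → ℝ)
    (hz : |z i0 - D * e| ≤ D - 1) : glueFn i0 D G z = G e z := by
  unfold glueFn
  set e' := round (z i0 / D) with he'
  by_cases hee : e' = e
  · rw [hee]
  have hD0 : 0 < D := by linarith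
  have h1 : |z i0 - D * e'| ≤ D / 2 := by
    have := abs_sub_round (z i0 / D)
    rw [← he'] at this
    have h2 : z i0 - D * e' = D * (z i0 / D - e') := by field_simp
    rw [h2, abs_mul, abs_of_pos hD0]
    nlinarith
  have h3 : D ≤ |D * (e' : ℝ) - D * e| := by
    rw [← mul_sub, abs_mul, abs_of_pos hD0]
    have : (1 : ℝ) ≤ |(e' : ℝ) - e| := by
      have : (1 : ℤ) ≤ |e' - e| := Int.one_le_abs (sub_ne_zero.2 hee)
      exact_mod_cast this
    nlinarith
  have h4 : |D * (e' : ℝ) - D * e| ≤ |z i0 - D * e'| + |z i0 - D * e| := by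
    rw [abs_sub_comm (z i0) (D * e')]
    refine le_trans (le_of_eq ?_) (abs_add_le _ _)
    congr 1; ring
  rw [hG e' z (by linarith), hG e z (by linarith)]

theorem iterDiff_glueFn {N : ℕ} (M : ℕ) (i0 : Fin N) (D : ℝ) (hD : 2 * M + 2 ≤ D)
    (G : ℤ → (Fin N → ℝ) → ℝ)
    (hG : ∀ (e : ℤ) (z : Fin N → ℝ), 1 / 2 ≤ |z i0 - D * e| → G e z = 0) (h : Fin N → ℝ) (hh : ‖h‖ ≤ 1)
    (z : Fin N → ℝ) :
    iterDiff M (glueFn i0 D G) h z = iterDiff M (G (round (z i0 / D))) h z := by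
  unfold iterDiff
  refine Finset.sum_congr rfl fun i hi => ?_
  have hM : (0 : ℝ) ≤ M := Nat.cast_nonneg _
  congr 1
  apply glueFn_local i0 D (by linarith) G hG
  have hi' : (i : ℝ) ≤ M := by
    exact_mod_cast Nat.lt_succ_iff.1 (Finset.mem_range.1 hi)
  set e' := round (z i0 / D) with he'
  have hD0 : 0 < D := by linarith
  have h1 : |z i0 - D * e'| ≤ D / 2 := by
    have := abs_sub_round (z i0 / D)
    rw [← he'] at this
    have h2 : z i0 - D * e' = D * (z i0 / D - e') := by field_simp
    rw [h2, abs_mul, abs_of_pos hD0]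
    nlinarith
  have h2 : |h i0| ≤ 1 := (norm_le_pi_norm h i0).trans hh
  have h3 : (z + (i : ℝ) • h) i0 - D * e' = (z i0 - D * e') + i * h i0 := by
    simp; ring
  rw [h3]
  refine (abs_add_le _ _).trans ?_
  rw [abs_mul, Nat.abs_cast]
  have : (i : ℝ) * |h i0| ≤ M * 1 := by gcongr
  linarith

theorem measurable_glueFn {N : ℕ} (i0 : Fin N) (D : ℝ) (G : ℤ → (Fin N → ℝ) → ℝ)
    (hG : ∀ e, Measurable (G e)) : Measurable (glueFn i0 D G) := by
  have h1 : Measurable (fun q : (Fin N → ℝ) × ℤ => G q.2 q.1) :=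
    measurable_from_prod_countable_left hG
  have h2 : Measurable (fun z : Fin N → ℝ => (z, round (z i0 / D))) := by
    refine measurable_id.prodMk ?_
    have : Measurable (fun x : ℝ => round x) := by
      simp_rw [round_eq]
      exact Int.measurable_floor.comp (measurable_id.add_const _)
    have h3 : Measurable (fun z : Fin N → ℝ => z i0 / D) := by fun_prop
    exact this.comp h3
  exact h1.comp h2

theorem lintegral_le_tsum_of_select {N : ℕ} (P : ℝ) (F : (Fin N → ℝ) → ℝ)
    (K : ℤ → (Fin N → ℝ) → ℝ) (hK : ∀ e, Measurable (K e)) (sel : (Fin N → ℝ) → ℤ)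
    (hF : ∀ z, F z = K (sel z) z) :
    ∫⁻ z, ‖F z‖ₑ ^ P ≤ ∑' e, ∫⁻ z, ‖K e z‖ₑ ^ P := by
  rw [← lintegral_tsum fun e => ((hK e).enorm.pow_const P).aemeasurable]
  refine lintegral_mono fun z => ?_
  rw [hF z]
  exact ENNReal.le_tsum (f := fun e => ‖K e z‖ₑ ^ P) (sel z)

theorem measurable_iterDiff {N : ℕ} (M : ℕ) (f : (Fin N → ℝ) → ℝ) (hf : Measurable f)
    (h : Fin N → ℝ) : Measurable (iterDiff M f h) := by
  unfold iterDiff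
  refine Finset.measurable_sum _ fun i _ => ?_
  exact (hf.comp (measurable_id.add_const _)).const_mul _

/-- `L^p` bounds for the glued sum of rescaled bumps. -/
theorem lintegral_glue {N : ℕ} (M : ℕ) (φ : (Fin N → ℝ) → ℝ) (hφ : ContDiff ℝ ∞ φ)
    (hc : HasCompactSupport φ) (h0 : ∀ z, 1 / 2 ≤ ‖z‖ → φ z = 0) (P : ℝ) (hP : 0 < P)
    (i0 : Fin N) (D : ℝ) (hD : 2 * M + 2 ≤ D) :
    ∃ C : ℝ≥0∞, C ≠ ⊤ ∧ ∀ (A : ℤ → ℝ) (j : ℤ → ℕ) (c : ℤ → Fin N → ℝ),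
      (∀ e, c e i0 = D * e) →
      (∫⁻ z, ‖glueFn i0 D (fun e z => A e * φ ((2 : ℝ) ^ j e • (z - c e))) z‖ₑ ^ P ≤
        C * ∑' e, ‖A e‖ₑ ^ P * ENNReal.ofReal (((2 : ℝ) ^ j e) ^ N)⁻¹) ∧
      ∀ h : Fin N → ℝ, ‖h‖ ≤ 1 →
      ∫⁻ z, ‖iterDiff M (glueFn i0 D (fun e z => A e * φ ((2 : ℝ) ^ j e • (z - c e)))) h z‖ₑ ^ P ≤
        C * ∑' e, ‖A e‖ₑ ^ P * ENNReal.ofReal (((2 : ℝ) ^ j e) ^ N)⁻¹ *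
          ENNReal.ofReal (min 1 (((2 : ℝ) ^ j e * ‖h‖) ^ M)) ^ P := by
  obtain ⟨C0, hC0, hb0⟩ := lintegral_iterDiff_bump 0 φ hφ hc h0 P hP
  obtain ⟨C1, hC1, hb1⟩ := lintegral_iterDiff_bump M φ hφ hc h0 P hP
  refine ⟨max C0 C1, by simp [hC0, hC1], fun A j c hcc => ?_⟩
  set G : ℤ → (Fin N → ℝ) → ℝ := fun e z => A e * φ ((2 : ℝ) ^ j e • (z - c e)) with hGdef
  have hGm : ∀ e, Measurable (G e) := fun e => by
    have : Continuous (G e) := by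
      have := hφ.continuous
      fun_prop
    exact this.measurable
  have hG0 : ∀ (e : ℤ) (z : Fin N → ℝ), 1 / 2 ≤ |z i0 - D * e| → G e z = 0 := by
    intro e z hz
    rw [hGdef]
    simp only
    rw [h0, mul_zero]
    rw [norm_smul]
    rw [← hcc] at hz
    have h1 : |z i0 - c e i0| ≤ ‖z - c e‖ := norm_le_pi_norm (z - c e) i0
    have h2 : (1 : ℝ) ≤ ‖(2 : ℝ) ^ j e‖ := by
      rw [norm_pow]; exact one_le_pow₀ (by norm_num)
    nlinarith
  have hInteg : ∀ (M : ℕ) e h, ∫⁻ z, ‖iterDiff M (G e) h z‖ₑ ^ P =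
      ‖A e‖ₑ ^ P * ENNReal.ofReal (((2 : ℝ) ^ j e) ^ N)⁻¹ *
        ∫⁻ z, ‖iterDiff M φ ((2 : ℝ) ^ j e • h) z‖ₑ ^ P := by
    intro M e h
    simp_rw [hGdef, iterDiff_comp_smul, enorm_mul, ENNReal.mul_rpow_of_nonneg _ _ hP.le]
    rw [lintegral_const_mul']
    · rw [lintegral_comp_smul_sub (c e) _ (by positivity)
        (fun z => ‖iterDiff M φ ((2 : ℝ) ^ j e • h) z‖ₑ ^ P), mul_assoc]
    · exact ENNReal.rpow_ne_top_of_nonneg hP.le enorm_ne_top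
  constructor
  · refine (lintegral_le_tsum_of_select P (glueFn i0 D G) G hGm (fun z => round (z i0 / D))
      (fun z => rfl)).trans ?_
    rw [← ENNReal.tsum_mul_left]
    refine ENNReal.tsum_le_tsum fun e => ?_
    have h1 := hInteg 0 e 0
    have h2 : ∀ z, iterDiff 0 (G e) 0 z = G e z := fun z => by simp [iterDiff]
    simp_rw [h2] at h1
    rw [h1, mul_comm]
    gcongr
    refine (hb0 _).trans ?_
    simp
  · intro h hh
    refine (lintegral_le_tsum_of_select P _ (fun e => iterDiff M (G e) h)
      (fun e => measurable_iterDiff M _ (hGm e) h) (fun z => round (z i0 / D))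
      (fun z => iterDiff_glueFn M i0 D hD G hG0 h hh z)).trans ?_
    rw [← ENNReal.tsum_mul_left]
    refine ENNReal.tsum_le_tsum fun e => ?_
    rw [hInteg M e h]
    calc _ ≤ ‖A e‖ₑ ^ P * ENNReal.ofReal (((2 : ℝ) ^ j e) ^ N)⁻¹ *
          (max C0 C1 * ENNReal.ofReal (min 1 (((2 : ℝ) ^ j e * ‖h‖) ^ M)) ^ P) := by
          gcongr
          refine (hb1 _).trans ?_
          rw [norm_smul, norm_pow, Real.norm_ofNat]
          gcongr
          exact le_max_right _ _
      _ = _ := by ring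

/-- The kernel `min (u^c) (u^{-c})`. -/
noncomputable def gker (c u : ℝ) : ℝ := min (u ^ c) (u ^ (-c))

theorem gker_nonneg (c u : ℝ) (hu : 0 ≤ u) : 0 ≤ gker c u :=
  le_min (Real.rpow_nonneg hu _) (Real.rpow_nonneg hu _)

theorem tsum_gker (c : ℝ) (hc : 0 < c) : ∃ C : ℝ≥0∞, C ≠ ⊤ ∧ ∀ t : ℝ, 0 < t →
    ∑' j : ℕ, ENNReal.ofReal (gker c ((2 : ℝ) ^ j * t)) ≤ C := by
  have hsum : Summable (fun n : ℤ => (2 : ℝ) ^ c * (2 : ℝ) ^ (-c * |(n : ℝ)|)) := by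
    refine Summable.mul_left _ ?_
    have hg : Summable (fun n : ℕ => ((2 : ℝ) ^ (-c)) ^ n) := by
      refine summable_geometric_of_lt_one (by positivity) ?_
      exact Real.rpow_lt_one_of_one_lt_of_neg (by norm_num) (by linarith)
    refine Summable.of_nat_of_neg ?_ ?_
    · refine hg.congr fun n => ?_
      rw [← Real.rpow_natCast, ← Real.rpow_mul (by norm_num)]
      simp
    · refine hg.congr fun n => ?_
      rw [← Real.rpow_natCast, ← Real.rpow_mul (by norm_num)]
      simp
  refine ⟨∑' n : ℤ, ENNReal.ofReal ((2 : ℝ) ^ c * (2 : ℝ) ^ (-c * |(n : ℝ)|)),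
    hsum.tsum_ofReal_ne_top, fun t ht => ?_⟩
  set τ := Real.logb 2 t with hτ
  have ht2 : t = (2 : ℝ) ^ τ := (Real.rpow_logb (by norm_num) (by norm_num) ht).symm
  set m : ℤ := ⌊τ⌋ with hm
  have hinj : Function.Injective (fun j : ℕ => (j : ℤ) + m) := by
    intro a b h; simpa using h
  refine le_trans (ENNReal.tsum_le_tsum fun j => ?_) (ENNReal.tsum_comp_le_tsum_of_injective hinj
    (fun n : ℤ => ENNReal.ofReal ((2 : ℝ) ^ c * (2 : ℝ) ^ (-c * |(n : ℝ)|))))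
  apply ENNReal.ofReal_le_ofReal
  have h2 : (2 : ℝ) ^ j * t = (2 : ℝ) ^ ((j : ℝ) + τ) := by
    rw [Real.rpow_add (by norm_num), ← ht2, Real.rpow_natCast]
  rw [gker, h2, ← Real.rpow_mul (by norm_num), ← Real.rpow_mul (by norm_num),
    ← Real.rpow_add (by norm_num)]
  push_cast
  have hf1 : (m : ℝ) ≤ τ := Int.floor_le τ
  have hf2 : τ < m + 1 := Int.lt_floor_add_one τ
  rcases le_total 0 ((j : ℝ) + m) with h | h
  · refine (min_le_right _ _).trans ?_
    apply Real.rpow_le_rpow_of_exponent_le (by norm_num)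
    rw [abs_of_nonneg h]; nlinarith
  · refine (min_le_left _ _).trans ?_
    apply Real.rpow_le_rpow_of_exponent_le (by norm_num)
    rw [abs_of_nonpos h]; nlinarith

theorem lintegral_gker (N : ℕ) (hN : 1 ≤ N) (c : ℝ) (hc : 0 < c) :
    ∃ C : ℝ≥0∞, C ≠ ⊤ ∧ ∀ j : ℕ, ∫⁻ h : Fin N → ℝ,
      ENNReal.ofReal (gker c ((2 : ℝ) ^ j * ‖h‖) * ‖h‖ ^ (-(N : ℝ))) ≤ C := by
  have : Nonempty (Fin N) := ⟨⟨0, hN⟩⟩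
  have : Nontrivial (Fin N → ℝ) := inferInstance
  refine ⟨∫⁻ h : Fin N → ℝ, ENNReal.ofReal (gker c ‖h‖ * ‖h‖ ^ (-(N : ℝ))), ?_, fun j => ?_⟩
  · have hInteg : Integrable (fun h : Fin N → ℝ => (fun u : ℝ => gker c u * u ^ (-(N : ℝ))) ‖h‖) := by
      rw [integrable_fun_norm_addHaar (volume : Measure (Fin N → ℝ))
        (f := fun u : ℝ => gker c u * u ^ (-(N : ℝ)))]
      have key : ∀ y : ℝ, 0 < y → y ^ (Module.finrank ℝ (Fin N → ℝ) - 1) •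
          (gker c y * y ^ (-(N : ℝ))) = gker c y * y ^ (-1 : ℝ) := by
        intro y hy
        rw [Module.finrank_fin_fun, smul_eq_mul, mul_left_comm, ← Real.rpow_natCast,
          ← Real.rpow_add hy, Nat.cast_sub hN]
        congr 2; push_cast; ring
      rw [integrableOn_congr_fun (s := Set.Ioi (0 : ℝ)) (fun y hy => key y hy) measurableSet_Ioi]
      have hm : Measurable (fun y : ℝ => gker c y * y ^ (-1 : ℝ)) := by
        unfold gker; fun_prop
      rw [← Set.Ioc_union_Ioi_eq_Ioi (zero_le_one' ℝ)]
      refine IntegrableOn.union ?_ ?_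
      · have h1 : IntegrableOn (fun y : ℝ => y ^ (c - 1)) (Set.Ioc 0 1) := by
          rw [← intervalIntegrable_iff_integrableOn_Ioc_of_le zero_le_one]
          exact intervalIntegral.intervalIntegrable_rpow' (by linarith)
        refine Integrable.mono' h1 hm.aestronglyMeasurable ?_
        refine (ae_restrict_iff' measurableSet_Ioc).2 (ae_of_all _ fun y hy => ?_)
        have hy0 := hy.1
        rw [Real.norm_of_nonneg (mul_nonneg (gker_nonneg _ _ hy0.le) (by positivity)),
          sub_eq_add_neg, Real.rpow_add hy0]
        gcongr
        exact min_le_left _ _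
      · have h1 : IntegrableOn (fun y : ℝ => y ^ (-c - 1)) (Set.Ioi 1) :=
          integrableOn_Ioi_rpow_of_lt (by linarith) zero_lt_one
        refine Integrable.mono' h1 hm.aestronglyMeasurable ?_
        refine (ae_restrict_iff' measurableSet_Ioi).2 (ae_of_all _ fun y hy => ?_)
        have hy0 : (0 : ℝ) < y := zero_lt_one.trans hy
        rw [Real.norm_of_nonneg (mul_nonneg (gker_nonneg _ _ hy0.le) (by positivity)),
          sub_eq_add_neg, Real.rpow_add hy0]
        gcongr
        exact min_le_right _ _
    exact hInteg.lintegral_lt_top.ne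
  · have h1 := lintegral_comp_smul_sub (N := N) 0 ((2 : ℝ) ^ j) (by positivity)
      (fun h => ENNReal.ofReal (gker c ‖h‖ * ‖h‖ ^ (-(N : ℝ))))
    have hl : (0 : ℝ) < ((2 : ℝ) ^ j) ^ N := by positivity
    have h2 : ∀ z : Fin N → ℝ, ENNReal.ofReal (gker c ((2 : ℝ) ^ j * ‖z‖) * ‖z‖ ^ (-(N : ℝ))) =
        ENNReal.ofReal (((2 : ℝ) ^ j) ^ N) *
        ENNReal.ofReal (gker c ‖(2 : ℝ) ^ j • (z - 0)‖ * ‖(2 : ℝ) ^ j • (z - 0)‖ ^ (-(N : ℝ))) := by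
      intro z
      rw [← ENNReal.ofReal_mul hl.le, sub_zero, norm_smul, norm_pow, Real.norm_ofNat,
        Real.mul_rpow (by positivity) (norm_nonneg _), Real.rpow_neg (x := (2 : ℝ) ^ j) (by positivity),
        Real.rpow_natCast]
      congr 1
      field_simp
    simp_rw [h2]
    rw [lintegral_const_mul' _ _ ENNReal.ofReal_ne_top, h1, ← mul_assoc, ← ENNReal.ofReal_mul hl.le,
      mul_inv_cancel₀ hl.ne']
    simp

theorem gker_bound (s P : ℝ) (M : ℕ) (hP : 0 < P) (hs : 0 < s) (hM : s < M) (u : ℝ) (hu : 0 < u) :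
    u ^ (-(s * P)) * (min 1 (u ^ M)) ^ P ≤ gker (min (s * P) ((M - s) * P)) u := by
  have c0 : 0 < min (s * P) ((M - s) * P) :=
    lt_min (by positivity) (mul_pos (by linarith) hP)
  have c1 : 0 < s * P := by positivity
  have c2 : 0 < (M - s) * P := mul_pos (by linarith) hP
  have e1 : u ^ (-(s * P)) * (u ^ M) ^ P = u ^ ((M - s) * P) := by
    rw [← Real.rpow_natCast, ← Real.rpow_mul hu.le, ← Real.rpow_add hu]; congr 1; ring
  rcases le_total u 1 with h | h
  · have h1 : u ^ (-(s * P)) * (min 1 (u ^ M)) ^ P ≤ u ^ ((M - s) * P) := by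
      rw [← e1]; gcongr; exact min_le_right _ _
    refine le_min (h1.trans ?_) (h1.trans ?_)
    · exact Real.rpow_le_rpow_of_exponent_ge hu h (min_le_right _ _)
    · apply Real.rpow_le_rpow_of_exponent_ge hu h
      linarith
  · have h1 : u ^ (-(s * P)) * (min 1 (u ^ M)) ^ P ≤ u ^ (-(s * P)) := by
      have : (min 1 (u ^ M)) ^ P ≤ (1 : ℝ) :=
        Real.rpow_le_one (by positivity) (min_le_left _ _) hP.le
      exact mul_le_of_le_one_right (by positivity) this
    refine le_min (h1.trans ?_) (h1.trans ?_)
    · apply Real.rpow_le_rpow_of_exponent_le h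
      linarith
    · apply Real.rpow_le_rpow_of_exponent_le h
      exact neg_le_neg (min_le_left _ _)

theorem tsum_jensen (r : ℝ) (hr : 1 ≤ r) (w f : ℕ → ℝ≥0∞) :
    (∑' j, w j * f j) ^ r ≤ (∑' j, w j) ^ (r - 1) * ∑' j, w j * f j ^ r := by
  have hr0 : 0 < r := by linarith
  have h1 : ∑' j, w j * f j ≤ (∑' j, w j) ^ (1 - r⁻¹) * (∑' j, w j * f j ^ r) ^ r⁻¹ := by
    rw [ENNReal.tsum_eq_iSup_sum]
    refine iSup_le fun t => ?_
    refine (ENNReal.inner_le_weight_mul_Lp_of_nonneg t hr w f).trans ?_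
    have : 0 ≤ 1 - r⁻¹ := by
      rw [sub_nonneg]; exact inv_le_one_of_one_le₀ hr
    gcongr
    · exact ENNReal.sum_le_tsum t
    · exact ENNReal.sum_le_tsum t
  calc _ ≤ ((∑' j, w j) ^ (1 - r⁻¹) * (∑' j, w j * f j ^ r) ^ r⁻¹) ^ r := by gcongr
    _ = _ := by
      rw [ENNReal.mul_rpow_of_nonneg _ _ hr0.le, ← ENNReal.rpow_mul, ← ENNReal.rpow_mul,
        inv_mul_cancel₀ hr0.ne', ENNReal.rpow_one, sub_mul, inv_mul_cancel₀ hr0.ne', one_mul]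

theorem memBesov_of_bounds (N : ℕ) (hN : 1 ≤ N) (p q : ℝ≥0∞) (hp : 0 < p) (hpq : p < q)
    (s : ℝ) (hs : 0 < s) (f : (Fin N → ℝ) → ℝ) (hf : Measurable f) (C : ℝ≥0∞) (hC : C ≠ ⊤)
    (B : ℕ → ℝ≥0∞)
    (h1 : ∫⁻ z, ‖f z‖ₑ ^ p.toReal ≤
      C * ∑' j : ℕ, ENNReal.ofReal (((2 : ℝ) ^ j) ^ (-(s * p.toReal))) * B j)
    (h2 : ∀ h : Fin N → ℝ, ‖h‖ ≤ 1 → ∫⁻ z, ‖iterDiff (⌊s⌋₊ + 1) f h z‖ₑ ^ p.toReal ≤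
      C * ∑' j : ℕ, ENNReal.ofReal (((2 : ℝ) ^ j) ^ (-(s * p.toReal))) * B j *
        ENNReal.ofReal (min 1 (((2 : ℝ) ^ j * ‖h‖) ^ (⌊s⌋₊ + 1))) ^ p.toReal)
    (hB1 : q = ⊤ → ∃ K : ℝ≥0∞, K ≠ ⊤ ∧ ∀ j, B j ≤ K)
    (hB2 : q ≠ ⊤ → ∑' j, B j ^ (q.toReal / p.toReal) ≠ ⊤) :
    MemBesov N p q s f := by
  have hpt : p ≠ ⊤ := hpq.ne_top
  set P := p.toReal with hPdef
  have hP : 0 < P := ENNReal.toReal_pos hp.ne' hpt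
  set M := ⌊s⌋₊ + 1 with hM
  have hsM : s < (M : ℝ) := by rw [hM]; exact_mod_cast Nat.lt_floor_add_one s
  set c := min (s * P) ((M - s) * P) with hcdef
  have hc : 0 < c := lt_min (by positivity) (mul_pos (by linarith) hP)
  have hr1 : q ≠ ⊤ → 1 ≤ q.toReal / P := fun hq => by
    rw [one_le_div hP]; exact ENNReal.toReal_mono hq hpq.le
  have hB : ∃ K : ℝ≥0∞, K ≠ ⊤ ∧ ∀ j, B j ≤ K := by
    by_cases hq : q = ⊤
    · exact hB1 hq
    · have hr0 : 0 < q.toReal / P := by linarith [hr1 hq]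
      refine ⟨(∑' j, B j ^ (q.toReal / P)) ^ (q.toReal / P)⁻¹,
        ENNReal.rpow_ne_top_of_nonneg (by positivity) (hB2 hq), fun j => ?_⟩
      calc B j = (B j ^ (q.toReal / P)) ^ (q.toReal / P)⁻¹ := by
            rw [← ENNReal.rpow_mul, mul_inv_cancel₀ hr0.ne', ENNReal.rpow_one]
        _ ≤ _ := by
            gcongr
            exact ENNReal.le_tsum (f := fun j => B j ^ (q.toReal / P)) j
  obtain ⟨K, hK, hBK⟩ := hB
  obtain ⟨C1, hC1, hg1⟩ := tsum_gker c hc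
  obtain ⟨C2, hC2, hg2⟩ := lintegral_gker N hN c hc
  -- pointwise bound
  have h3 : ∀ h : Fin N → ℝ, ‖h‖ ≤ 1 → 0 < ‖h‖ → ∫⁻ z, ‖iterDiff M f h z‖ₑ ^ P ≤
      C * ENNReal.ofReal (‖h‖ ^ (s * P)) *
        ∑' j : ℕ, ENNReal.ofReal (gker c ((2 : ℝ) ^ j * ‖h‖)) * B j := by
    intro h hh h0
    refine (h2 h hh).trans ?_
    rw [mul_assoc]
    refine mul_le_mul' le_rfl ?_
    rw [← ENNReal.tsum_mul_left]
    refine ENNReal.tsum_le_tsum fun j => ?_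
    have hu : 0 < (2 : ℝ) ^ j * ‖h‖ := by positivity
    rw [ENNReal.ofReal_rpow_of_nonneg (by positivity) hP.le, mul_right_comm,
      ← ENNReal.ofReal_mul (by positivity), ← mul_assoc, ← ENNReal.ofReal_mul (by positivity)]
    refine mul_le_mul' (ENNReal.ofReal_le_ofReal ?_) le_rfl
    have := gker_bound s P M hP hs hsM _ hu
    calc _ = ‖h‖ ^ (s * P) * (((2 : ℝ) ^ j * ‖h‖) ^ (-(s * P)) *
          min 1 (((2 : ℝ) ^ j * ‖h‖) ^ M) ^ P) := by
          rw [Real.mul_rpow (by positivity) h0.le, Real.rpow_neg h0.le]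
          have : ‖h‖ ^ (s * P) ≠ 0 := by positivity
          field_simp
      _ ≤ _ := by gcongr
  refine ⟨hf.aestronglyMeasurable, ?_⟩
  rw [besovNorm, ENNReal.add_lt_top]
  constructor
  · rw [eLpNorm_eq_lintegral_rpow_enorm_toReal hp.ne' hpt]
    refine ENNReal.rpow_lt_top_of_nonneg (by positivity) ?_
    refine ne_top_of_le_ne_top ?_ h1
    refine ENNReal.mul_ne_top hC ?_
    have hle : ∑' j : ℕ, ENNReal.ofReal (((2 : ℝ) ^ j) ^ (-(s * P))) * B j ≤
        ∑' j : ℕ, ENNReal.ofReal (((2 : ℝ) ^ j) ^ (-(s * P))) * K := by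
      gcongr with j; exact hBK j
    refine ne_top_of_le_ne_top ?_ hle
    rw [ENNReal.tsum_mul_right]
    refine ENNReal.mul_ne_top (Summable.tsum_ofReal_ne_top ?_) hK
    have hg : Summable (fun n : ℕ => ((2 : ℝ) ^ (-(s * P))) ^ n) := by
      refine summable_geometric_of_lt_one (by positivity) ?_
      refine Real.rpow_lt_one_of_one_lt_of_neg (by norm_num) ?_
      have : 0 < s * P := by positivity
      linarith
    refine hg.congr fun n => ?_
    rw [← Real.rpow_natCast, ← Real.rpow_natCast, ← Real.rpow_mul (by norm_num),
      ← Real.rpow_mul (by norm_num), mul_comm]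
  have hlp : ∀ h, eLpNorm (iterDiff M f h) p volume =
      (∫⁻ z, ‖iterDiff M f h z‖ₑ ^ P) ^ (1 / P) := fun h =>
    eLpNorm_eq_lintegral_rpow_enorm_toReal hp.ne' hpt
  by_cases hq : q = ⊤
  · rw [if_pos hq]
    have hbd : (C * (C1 * K)) ^ (1 / P) < ⊤ :=
      ENNReal.rpow_lt_top_of_nonneg (by positivity)
        (ENNReal.mul_ne_top hC (ENNReal.mul_ne_top hC1 hK))
    refine lt_of_le_of_lt (iSup₂_le fun h hh => ?_) hbd
    rcases (norm_nonneg h).eq_or_lt with h0 | h0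
    · rw [← h0, Real.zero_rpow (by linarith)]; simp
    rw [hlp h]
    calc _ ≤ (C * ENNReal.ofReal (‖h‖ ^ (s * P)) * (C1 * K)) ^ (1 / P) *
          ENNReal.ofReal (‖h‖ ^ (-s)) := by
          gcongr
          refine (h3 h hh h0).trans ?_
          gcongr
          calc _ ≤ ∑' j : ℕ, ENNReal.ofReal (gker c ((2 : ℝ) ^ j * ‖h‖)) * K := by
                gcongr with j; exact hBK j
            _ ≤ _ := by rw [ENNReal.tsum_mul_right]; gcongr; exact hg1 _ h0
      _ = _ := by
          rw [mul_right_comm, ENNReal.mul_rpow_of_nonneg _ _ (by positivity),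
            ENNReal.ofReal_rpow_of_nonneg (x := ‖h‖ ^ (s * P)) (by positivity) (by positivity),
            mul_assoc, ← ENNReal.ofReal_mul (by positivity), ← Real.rpow_mul h0.le,
            ← Real.rpow_add h0]
          have : s * P * (1 / P) + -s = 0 := by field_simp; ring
          rw [this]; simp
  · rw [if_neg hq]
    set Q := q.toReal with hQ
    set r := Q / P with hr
    have hr1 := hr1 hq
    have hQ0 : 0 < Q := ENNReal.toReal_pos (hp.trans hpq).ne' hq
    refine ENNReal.rpow_lt_top_of_nonneg (by positivity) ?_
    set S : ℝ≥0∞ := C ^ r * C1 ^ (r - 1) with hS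
    have hSt : S ≠ ⊤ := ENNReal.mul_ne_top (ENNReal.rpow_ne_top_of_nonneg (by linarith) hC)
      (ENNReal.rpow_ne_top_of_nonneg (by linarith) hC1)
    have hpt : ∀ h : Fin N → ℝ, ‖h‖ ≤ 1 → eLpNorm (iterDiff M f h) p volume ^ Q *
        ENNReal.ofReal (‖h‖ ^ (-(N : ℝ) - s * Q)) ≤
        S * ∑' j : ℕ, ENNReal.ofReal (gker c ((2 : ℝ) ^ j * ‖h‖) * ‖h‖ ^ (-(N : ℝ))) * B j ^ r := by
      intro h hh
      rcases (norm_nonneg h).eq_or_lt with h0 | h0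
      · rw [← h0, Real.zero_rpow]
        · simp
        · have : 0 < s * Q := by positivity
          have : (0 : ℝ) ≤ N := Nat.cast_nonneg _
          linarith
      rw [hlp h, ← ENNReal.rpow_mul]
      have : 1 / P * Q = r := by rw [hr]; ring
      rw [this]
      calc _ ≤ (C * ENNReal.ofReal (‖h‖ ^ (s * P)) *
          ∑' j : ℕ, ENNReal.ofReal (gker c ((2 : ℝ) ^ j * ‖h‖)) * B j) ^ r *
          ENNReal.ofReal (‖h‖ ^ (-(N : ℝ) - s * Q)) := by
            gcongr; exact h3 h hh h0
        _ = C ^ r * (∑' j : ℕ, ENNReal.ofReal (gker c ((2 : ℝ) ^ j * ‖h‖)) * B j) ^ r *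
            ENNReal.ofReal (‖h‖ ^ (-(N : ℝ))) := by
            rw [mul_right_comm, ENNReal.mul_rpow_of_nonneg _ _ (by linarith),
              ENNReal.mul_rpow_of_nonneg _ _ (by linarith),
              ENNReal.ofReal_rpow_of_nonneg (x := ‖h‖ ^ (s * P)) (by positivity) (by linarith),
              mul_assoc, ← ENNReal.ofReal_mul (by positivity), ← Real.rpow_mul h0.le,
              ← Real.rpow_add h0]
            congr 3
            rw [hr]; field_simp; ring_nf
        _ ≤ C ^ r * (C1 ^ (r - 1) *
            ∑' j : ℕ, ENNReal.ofReal (gker c ((2 : ℝ) ^ j * ‖h‖)) * B j ^ r) *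
            ENNReal.ofReal (‖h‖ ^ (-(N : ℝ))) := by
            gcongr
            refine (tsum_jensen r hr1 _ _).trans ?_
            have : 0 ≤ r - 1 := by linarith
            gcongr
            exact hg1 _ h0
        _ = _ := by
            rw [hS, ← mul_assoc, mul_assoc, ← ENNReal.tsum_mul_right]
            congr 2
            ext j
            rw [ENNReal.ofReal_mul (gker_nonneg _ _ (by positivity))]
            ring
    have hms : MeasurableSet {h : Fin N → ℝ | ‖h‖ ≤ 1} :=
      measurableSet_le measurable_norm measurable_const
    refine ne_top_of_le_ne_top ?_ (setLIntegral_mono' hms fun h hh => hpt h hh)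
    refine ne_top_of_le_ne_top ?_ (setLIntegral_le_lintegral _ _)
    rw [lintegral_const_mul' _ _ hSt]
    refine ENNReal.mul_ne_top hSt ?_
    rw [lintegral_tsum]
    · have : ∑' j : ℕ, ∫⁻ h : Fin N → ℝ,
          ENNReal.ofReal (gker c ((2 : ℝ) ^ j * ‖h‖) * ‖h‖ ^ (-(N : ℝ))) * B j ^ r ≤
          ∑' j : ℕ, C2 * B j ^ r := by
        refine ENNReal.tsum_le_tsum fun j => ?_
        rw [lintegral_mul_const']
        · gcongr; exact hg2 j
        · exact ENNReal.rpow_ne_top_of_nonneg (by linarith) (ne_top_of_le_ne_top hK (hBK j))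
      refine ne_top_of_le_ne_top ?_ this
      rw [ENNReal.tsum_mul_left]
      exact ENNReal.mul_ne_top hC2 (hB2 hq)
    · intro j
      have : Measurable (fun h : Fin N → ℝ => gker c ((2 : ℝ) ^ j * ‖h‖) * ‖h‖ ^ (-(N : ℝ))) := by
        unfold gker; fun_prop
      exact (this.ennreal_ofReal.mul_const _).aemeasurable

theorem abel_dini (a : ℕ → ℝ) (ha : ∀ j, 0 < a j) (ha1 : ∀ j, a j ≤ 1) (hdiv : ¬ Summable a) :
    ∃ S : ℕ → ℝ, (∀ j, 1 ≤ S j) ∧ Tendsto S atTop atTop ∧ ¬ Summable (fun j => a j / S j) ∧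
      ∀ r : ℝ, 1 < r → Summable (fun j => a j * S j ^ (-r)) := by
  set S : ℕ → ℝ := fun j => 1 + ∑ i ∈ Finset.range j, a i with hS
  have hS1 : ∀ j, 1 ≤ S j := fun j => by
    have : 0 ≤ ∑ i ∈ Finset.range j, a i := Finset.sum_nonneg fun i _ => (ha i).le
    simp only [hS]; linarith
  have hSs : ∀ j, S (j + 1) = S j + a j := fun j => by
    simp only [hS, Finset.sum_range_succ]; ring
  have hT0 : Tendsto (fun j => ∑ i ∈ Finset.range j, a i) atTop atTop :=
    (not_summable_iff_tendsto_nat_atTop_of_nonneg fun j => (ha j).le).1 hdiv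
  have hT : Tendsto S atTop atTop := tendsto_atTop_add_const_left _ 1 hT0
  have hS0 : ∀ j, 0 < S j := fun j => by linarith [hS1 j]
  refine ⟨S, hS1, hT, ?_, fun r hr => ?_⟩
  · rw [not_summable_iff_tendsto_nat_atTop_of_nonneg
      (fun j => (div_pos (ha j) (hS0 j)).le)]
    refine tendsto_atTop_mono (fun n => ?_) (Real.tendsto_log_atTop.comp hT)
    induction n with
    | zero => simp [hS]
    | succ n ih =>
      rw [Finset.sum_range_succ]
      have h1 : Real.log (S (n + 1)) - Real.log (S n) ≤ a n / S n := by
        rw [← Real.log_div (hS0 _).ne' (hS0 _).ne']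
        refine (Real.log_le_sub_one_of_pos (div_pos (hS0 _) (hS0 _))).trans (le_of_eq ?_)
        rw [hSs]; have := (hS0 n).ne'; field_simp; ring
      simp only [Function.comp] at ih ⊢
      linarith
  · have key : ∀ j, a j * S j ^ (-r) ≤
        2 ^ r / (r - 1) * (S j ^ (1 - r) - S (j + 1) ^ (1 - r)) := by
      intro j
      have hj := hS0 j
      have hj1 := hS0 (j + 1)
      have h2 : S (j + 1) ≤ 2 * S j := by rw [hSs]; linarith [ha1 j, hS1 j]
      have hv : 0 < S (j + 1) / S j := div_pos hj1 hj
      have h3 : (r - 1) * (a j / S (j + 1)) ≤ (S (j + 1) / S j) ^ (r - 1) - 1 := by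
        have e1 : (S (j + 1) / S j) ^ (r - 1) =
            Real.exp (Real.log (S (j + 1) / S j) * (r - 1)) := Real.rpow_def_of_pos hv _
        have e2 := Real.add_one_le_exp (Real.log (S (j + 1) / S j) * (r - 1))
        have e3 := Real.one_sub_inv_le_log_of_pos hv
        have e4 : 1 - (S (j + 1) / S j)⁻¹ = a j / S (j + 1) := by
          rw [inv_div, one_sub_div hj1.ne', hSs]; congr 1; ring
        rw [e4] at e3
        rw [e1]
        nlinarith
      have h4 : S j ^ (1 - r) - S (j + 1) ^ (1 - r) =
          S (j + 1) ^ (1 - r) * ((S (j + 1) / S j) ^ (r - 1) - 1) := by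
        have : (S (j + 1) / S j) ^ (r - 1) = S j ^ (1 - r) / S (j + 1) ^ (1 - r) := by
          rw [Real.div_rpow hj1.le hj.le, ← neg_sub 1 r, Real.rpow_neg hj1.le, Real.rpow_neg hj.le]
          field_simp
        rw [this]
        have : S (j + 1) ^ (1 - r) ≠ 0 := by positivity
        field_simp
      rw [h4]
      have h5 : S j ^ (-r) ≤ 2 ^ r * S (j + 1) ^ (-r) := by
        have : (2 * S j) ^ (-r) ≤ S (j + 1) ^ (-r) :=
          Real.rpow_le_rpow_of_nonpos hj1 h2 (by linarith)
        rw [Real.mul_rpow (by norm_num) hj.le, Real.rpow_neg (by norm_num)] at this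
        rwa [inv_mul_le_iff₀ (by positivity)] at this
      have hr1 : 0 < r - 1 := by linarith
      calc a j * S j ^ (-r) ≤ a j * (2 ^ r * S (j + 1) ^ (-r)) :=
            mul_le_mul_of_nonneg_left h5 (ha j).le
        _ = 2 ^ r / (r - 1) * (S (j + 1) ^ (1 - r) * ((r - 1) * (a j / S (j + 1)))) := by
            rw [sub_eq_add_neg 1 r, Real.rpow_add hj1, Real.rpow_one]
            field_simp
        _ ≤ _ := by gcongr
    refine summable_of_sum_range_le (c := 2 ^ r / (r - 1) * 1)
      (fun j => mul_nonneg (ha j).le (Real.rpow_nonneg (hS0 j).le _)) fun n => ?_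
    refine (Finset.sum_le_sum fun j _ => key j).trans ?_
    rw [← Finset.mul_sum, Finset.sum_range_sub']
    have hr1 : 0 < r - 1 := by linarith
    gcongr
    have h1 : S 0 = 1 := by simp [hS]
    rw [h1, Real.one_rpow]
    have := Real.rpow_nonneg (hS0 n).le (1 - r)
    linarith

theorem seq_lemma (P : ℝ) (hP : 0 < P) (χ : ℝ) (hχ : 0 < χ) (w : ℕ → ℝ) (hw : ∀ j, 0 < w j)
    (hw1 : ∀ j, w j ≤ 1) (hdiv : ¬ Summable fun j => w j ^ χ) :
    (χ = P → ∃ (b : ℕ → ℝ) (r : ℕ → ℕ), (∀ j, 0 < b j) ∧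
      ¬ Summable (fun j => (r j : ℝ) / 2 ^ j) ∧ (∀ j, b j ^ P * (r j / 2 ^ j) ≤ 1) ∧
      Tendsto (fun j => b j * w j) atTop atTop) ∧
    (∀ Q : ℝ, P < Q → χ = Q * P / (Q - P) → ∃ (b : ℕ → ℝ) (r : ℕ → ℕ), (∀ j, 0 < b j) ∧
      ¬ Summable (fun j => (r j : ℝ) / 2 ^ j) ∧
      Summable (fun j => (b j ^ P * (r j / 2 ^ j)) ^ (Q / P)) ∧ ∀ j, b j * w j = 1) := by
  obtain ⟨S, hS1, hST, hSd, hSs⟩ := abel_dini (fun j => w j ^ χ) (fun j => by have := hw j; positivity)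
    (fun j => Real.rpow_le_one (hw j).le (hw1 j) hχ.le) hdiv
  have hS0 : ∀ j, 0 < S j := fun j => by linarith [hS1 j]
  set r : ℕ → ℕ := fun j => ⌊2 ^ j * (w j ^ χ / S j)⌋₊ with hr
  have hx : ∀ j, 0 ≤ w j ^ χ / S j := fun j => by have := hw j; have := hS0 j; positivity
  have hr1 : ∀ j, (r j : ℝ) / 2 ^ j ≤ w j ^ χ / S j := fun j => by
    rw [div_le_iff₀ (by positivity), mul_comm]
    exact Nat.floor_le (mul_nonneg (by positivity) (hx j))
  have hr2 : ∀ j, w j ^ χ / S j ≤ (r j : ℝ) / 2 ^ j + (1 / 2) ^ j := fun j => by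
    have := (Nat.lt_floor_add_one (2 ^ j * (w j ^ χ / S j))).le
    rw [one_div, inv_pow, ← one_div, ← add_div, le_div_iff₀ (by positivity), mul_comm]
    exact this
  have hrd : ¬ Summable (fun j => (r j : ℝ) / 2 ^ j) := fun h => by
    apply hSd
    exact Summable.of_nonneg_of_le hx hr2 (h.add summable_geometric_two)
  constructor
  · intro hχP
    refine ⟨fun j => (w j)⁻¹ * S j ^ (1 / P), r, fun j => ?_, hrd, fun j => ?_, ?_⟩
    · have := hw j; have := hS0 j; positivity
    · have h1 := hw j
      have h2 := hS0 j
      refine (mul_le_mul_of_nonneg_left (hr1 j) (by positivity)).trans (le_of_eq ?_)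
      rw [Real.mul_rpow (by positivity) (by positivity), Real.inv_rpow h1.le, ← Real.rpow_mul h2.le,
        one_div_mul_cancel hP.ne', Real.rpow_one, hχP]
      have : w j ^ P ≠ 0 := by positivity
      field_simp
    · refine ((tendsto_rpow_atTop (y := 1 / P) (by positivity)).comp hST).congr fun j => ?_
      have h1 := (hw j).ne'
      simp only [Function.comp]
      field_simp
  · intro Q hPQ hχQ
    refine ⟨fun j => (w j)⁻¹, r, fun j => inv_pos.2 (hw j), hrd, ?_, fun j =>
      inv_mul_cancel₀ (hw j).ne'⟩
    have hrQ : 1 < Q / P := (one_lt_div hP).2 hPQ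
    refine Summable.of_nonneg_of_le (fun j => ?_) (fun j => ?_) (hSs (Q / P) hrQ)
    · have := hw j; positivity
    · have h1 := hw j
      have h2 := hS0 j
      calc _ ≤ ((w j)⁻¹ ^ P * (w j ^ χ / S j)) ^ (Q / P) := by
            exact Real.rpow_le_rpow (by positivity)
              (mul_le_mul_of_nonneg_left (hr1 j) (by positivity)) (by linarith)
        _ = _ := by
            rw [Real.mul_rpow (by positivity) (by positivity), Real.div_rpow (by positivity) h2.le,
              Real.inv_rpow h1.le, ← Real.rpow_neg h1.le, ← Real.rpow_mul h1.le, ← Real.rpow_mul h1.le,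
              Real.rpow_neg h2.le, mul_div_assoc', ← Real.rpow_add h1, div_eq_mul_inv]
            congr 2
            have : Q - P ≠ 0 := by linarith
            rw [hχQ]
            field_simp
            ring

/-- The starting positions (in units of `2^{-j-1}`) of the sweeping intervals. -/
def accSeq (r : ℕ → ℕ) : ℕ → ℕ
  | 0 => 0
  | j + 1 => 2 * (accSeq r j + r j)

theorem cover_one (r : ℕ → ℕ) (hr : ¬ Summable (fun j => (r j : ℝ) / 2 ^ j)) :
    ∃ R : ℕ → Finset ℕ, (∀ j, (R j).card ≤ r j) ∧ ∀ u : ℝ, 0 ≤ u → u < 1 →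
      ∃ᶠ j in atTop, ⌊2 ^ (j + 1) * u⌋₊ ∈ R j := by
  obtain ⟨A, hA0, hAs⟩ : ∃ A : ℕ → ℕ, A 0 = 0 ∧ ∀ j, A (j + 1) = 2 * (A j + r j) :=
    ⟨accSeq r, rfl, fun j => rfl⟩
  have hsum : ∀ j, (A j : ℝ) / 2 ^ j = ∑ i ∈ Finset.range j, (r i : ℝ) / 2 ^ i := by
    intro j
    induction j with
    | zero => simp [hA0]
    | succ j ih =>
      rw [Finset.sum_range_succ, ← ih, hAs]
      push_cast
      field_simp
      ring
  have hT : Tendsto (fun j => (A j : ℝ) / 2 ^ j) atTop atTop := by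
    simp_rw [hsum]
    exact (not_summable_iff_tendsto_nat_atTop_of_nonneg fun j => by positivity).1 hr
  refine ⟨fun j => (Finset.range (r j)).image (fun x => (A j + x) % 2 ^ (j + 1)), fun j =>
    Finset.card_image_le.trans (by simp), fun u hu0 hu1 => ?_⟩
  have hmono : Monotone (fun j => (A j : ℝ) / 2 ^ j) := by
    refine monotone_nat_of_le_succ fun j => ?_
    rw [hsum, hsum, Finset.sum_range_succ]
    have : (0 : ℝ) ≤ (r j : ℝ) / 2 ^ j := by positivity
    linarith
  rw [frequently_atTop]
  intro n
  obtain ⟨v, hv⟩ := exists_nat_ge ((A n : ℝ) / 2 ^ n)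
  have hex : ∃ j, 2 * (u + v) < (A (j + 1) : ℝ) / 2 ^ (j + 1) := by
    obtain ⟨j, hj⟩ := ((tendsto_add_atTop_iff_nat 1).2 hT).eventually_gt_atTop (2 * (u + v)) |>.exists
    exact ⟨j, hj⟩
  classical
  let j := Nat.find hex
  have hj1 : 2 * (u + v) < (A (j + 1) : ℝ) / 2 ^ (j + 1) := Nat.find_spec hex
  have hj0 : (A j : ℝ) / 2 ^ j ≤ 2 * (u + v) := by
    rcases Nat.eq_zero_or_pos j with h | h
    · rw [h, hA0]; simp; positivity
    · have h1 := Nat.find_min hex (m := j - 1) (by omega)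
      rw [Nat.sub_add_cancel h] at h1
      exact not_lt.1 h1
  have hv0 : (0 : ℝ) ≤ v := Nat.cast_nonneg v
  have hjn : n ≤ j := by
    by_contra hlt
    have := hmono (show j + 1 ≤ n by omega)
    simp only at this
    linarith
  refine ⟨j, hjn, ?_⟩
  set F := ⌊2 ^ (j + 1) * u⌋₊ with hF
  have hFlt : F < 2 ^ (j + 1) := by
    rw [hF, Nat.floor_lt (by positivity)]
    push_cast
    have : (0 : ℝ) < 2 ^ (j + 1) := by positivity
    nlinarith
  have hF1 : A j ≤ F + 2 ^ (j + 1) * v := by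
    have : F + 2 ^ (j + 1) * v = ⌊(2 : ℝ) ^ (j + 1) * u + ((2 ^ (j + 1) * v : ℕ) : ℝ)⌋₊ := by
      rw [Nat.floor_add_natCast (by positivity)]
    rw [this]
    apply Nat.le_floor
    rw [div_le_iff₀ (by positivity)] at hj0
    push_cast
    rw [pow_succ]
    linarith
  have hF2 : F + 2 ^ (j + 1) * v < A j + r j := by
    have : F + 2 ^ (j + 1) * v = ⌊(2 : ℝ) ^ (j + 1) * u + ((2 ^ (j + 1) * v : ℕ) : ℝ)⌋₊ := by
      rw [Nat.floor_add_natCast (by positivity)]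
    rw [this, Nat.floor_lt (by positivity)]
    rw [lt_div_iff₀ (by positivity), hAs] at hj1
    push_cast at hj1 ⊢
    linarith
  rw [Finset.mem_image]
  refine ⟨F + 2 ^ (j + 1) * v - A j, Finset.mem_range.2 (by omega), ?_⟩
  rw [Nat.add_sub_cancel' hF1, Nat.add_mul_mod_self_left, Nat.mod_eq_of_lt hFlt]

theorem cover_n (n : ℕ) (hn : 1 ≤ n) (r : ℕ → ℕ) (hr : ¬ Summable (fun j => (r j : ℝ) / 2 ^ j)) :
    ∃ W : ℕ → Finset (Fin n → ℕ), (∀ j, (W j).card ≤ r j * (2 ^ (j + 1)) ^ (n - 1)) ∧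
      ∀ y : Fin n → ℝ, ∃ᶠ j in atTop, ∃ w ∈ W j, ∀ i,
        |y i - (⌊y i⌋ + ((w i : ℝ) + 1 / 2) / 2 ^ (j + 1))| ≤ 1 / 4 / 2 ^ j := by
  obtain ⟨R, hR, hcov⟩ := cover_one r hr
  let i1 : Fin n := ⟨0, hn⟩
  refine ⟨fun j => Fintype.piFinset (fun i => if i = i1 then R j else Finset.range (2 ^ (j + 1))),
    fun j => ?_, fun y => ?_⟩
  · rw [Fintype.card_piFinset, ← Finset.mul_prod_erase _ _ (Finset.mem_univ i1), if_pos rfl]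
    refine Nat.mul_le_mul (hR j) (le_of_eq ?_)
    rw [Finset.prod_congr rfl (g := fun _ => 2 ^ (j + 1))]
    · simp
    · intro i hi
      rw [if_neg (Finset.ne_of_mem_erase hi), Finset.card_range]
  · refine (hcov (Int.fract (y i1)) (Int.fract_nonneg _) (Int.fract_lt_one _)).mono fun j hj => ?_
    refine ⟨fun i => ⌊2 ^ (j + 1) * Int.fract (y i)⌋₊, ?_, fun i => ?_⟩
    · rw [Fintype.mem_piFinset]
      intro i
      by_cases h : i = i1
      · rw [if_pos h, h]; exact hj
      · rw [if_neg h, Finset.mem_range, Nat.floor_lt (mul_nonneg (by positivity) (Int.fract_nonneg _))]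
        push_cast
        have : (0 : ℝ) < 2 ^ (j + 1) := by positivity
        have := Int.fract_lt_one (y i)
        nlinarith
    · set t := Int.fract (y i) with ht
      have hf1 := Nat.floor_le (a := 2 ^ (j + 1) * t)
        (mul_nonneg (by positivity) (Int.fract_nonneg _))
      have hf2 := Nat.lt_floor_add_one (2 ^ (j + 1) * t)
      set k : ℝ := (⌊2 ^ (j + 1) * t⌋₊ : ℝ) with hk
      have e : y i - (⌊y i⌋ + (k + 1 / 2) / 2 ^ (j + 1)) =
          (2 ^ (j + 1) * t - k - 1 / 2) / 2 ^ (j + 1) := by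
        have : y i = ⌊y i⌋ + t := (Int.floor_add_fract _).symm
        field_simp
        rw [ht, Int.fract]; ring
      rw [e, abs_div, abs_of_pos (a := (2 : ℝ) ^ (j + 1)) (by positivity),
        div_le_div_iff₀ (by positivity) (by positivity)]
      have h3 : |2 ^ (j + 1) * t - k - 1 / 2| ≤ 1 / 2 := by
        rw [abs_le]; constructor <;> linarith
      have h4 : (0 : ℝ) < 2 ^ j := by positivity
      rw [pow_succ]
      rw [pow_succ] at h3
      nlinarith

theorem psi_lower (Ψ : ℝ → ℝ) (hpos : ∀ t ∈ Set.Ioc (0 : ℝ) 1, 0 < Ψ t)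
    (hmon : MonotoneOn Ψ (Set.Ioc (0 : ℝ) 1) ∨ AntitoneOn Ψ (Set.Ioc (0 : ℝ) 1))
    (χ : ℝ) (hdiv : ¬ Summable fun j : ℕ => Ψ ((2 : ℝ) ^ (-(j : ℝ))) ^ χ) :
    ∃ (κ : ℝ) (w : ℕ → ℝ), 0 < κ ∧ (∀ j, 0 < w j) ∧ (∀ j, w j ≤ 1) ∧
      (¬ Summable fun j => w j ^ χ) ∧
      ∀ (j : ℕ) (t : ℝ), (1 / 2) ^ j ≤ t → t ≤ 1 → κ * w j ≤ Ψ t := by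
  have h1 : (1 : ℝ) ∈ Set.Ioc (0 : ℝ) 1 := by simp
  have hκ := hpos 1 h1
  have hmem : ∀ j : ℕ, ((1 : ℝ) / 2) ^ j ∈ Set.Ioc (0 : ℝ) 1 := fun j =>
    ⟨by positivity, pow_le_one₀ (by norm_num) (by norm_num)⟩
  have he : ∀ j : ℕ, (2 : ℝ) ^ (-(j : ℝ)) = (1 / 2) ^ j := fun j => by
    rw [Real.rpow_neg (by norm_num), Real.rpow_natCast]; simp
  rcases hmon with hm | hm
  · refine ⟨Ψ 1, fun j => Ψ ((1 / 2) ^ j) / Ψ 1, hκ, fun j => div_pos (hpos _ (hmem j)) hκ,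
      fun j => (div_le_one hκ).2 (hm (hmem j) h1 (hmem j).2), fun hs => hdiv ?_,
      fun j t ht ht1 => ?_⟩
    · refine (hs.mul_left (Ψ 1 ^ χ)).congr fun j => ?_
      rw [he, Real.div_rpow (hpos _ (hmem j)).le hκ.le]
      have : Ψ 1 ^ χ ≠ 0 := by positivity
      field_simp
    · rw [mul_div_cancel₀ _ hκ.ne']
      exact hm (hmem j) ⟨(hmem j).1.trans_le ht, ht1⟩ ht
  · refine ⟨Ψ 1, fun _ => 1, hκ, fun _ => one_pos, fun _ => le_rfl, ?_, fun j t ht ht1 => ?_⟩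
    · simp only [Real.one_rpow]
      intro h
      have := tendsto_nhds_unique h.tendsto_atTop_zero tendsto_const_nhds
      norm_num at this
    · rw [mul_one]
      exact hm ⟨(hmem j).1.trans_le ht, ht1⟩ h1 ht1

theorem bump_zero {N : ℕ} (φ : (Fin N → ℝ) → ℝ) (h0 : ∀ z, 1 / 2 ≤ ‖z‖ → φ z = 0)
    (i0 : Fin N) (j : ℕ) (A : ℝ) (c z : Fin N → ℝ) (hz : 1 / 2 ≤ |z i0 - c i0|) :
    A * φ ((2 : ℝ) ^ j • (z - c)) = 0 := by
  rw [h0, mul_zero]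
  rw [norm_smul]
  have h1 : |z i0 - c i0| ≤ ‖z - c‖ := norm_le_pi_norm (z - c) i0
  have h2 : (1 : ℝ) ≤ ‖(2 : ℝ) ^ j‖ := by
    rw [norm_pow]; exact one_le_pow₀ (by norm_num)
  nlinarith

/-- Centres of the atoms. -/
noncomputable def ctr (N d : ℕ) (x0 : ℝ) (y : Fin (N - d) → ℝ) : Fin N → ℝ :=
  fun i => if h : (i : ℕ) < d then (if (i : ℕ) = 0 then x0 else 0)
    else y ⟨(i : ℕ) - d, by have := i.isLt; omega⟩

theorem restr_lower (N d : ℕ) (hd : 1 ≤ d) (hdN : d < N) (M : ℕ)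
    (φ : (Fin N → ℝ) → ℝ) (hφ1 : ∀ z, ‖z‖ ≤ 1 / 4 → φ z = 1)
    (h0 : ∀ z, 1 / 2 ≤ ‖z‖ → φ z = 0) (p : ℝ≥0∞) (hp : 0 < p) (hpt : p ≠ ⊤)
    (A : ℤ → ℝ) (j : ℤ → ℕ) (yc : ℤ → Fin (N - d) → ℝ) (e : ℤ) (y : Fin (N - d) → ℝ)
    (hy : ∀ i, |y i - yc e i| ≤ 1 / 4 / 2 ^ j e) (hA : 0 ≤ A e) :
    ENNReal.ofReal (A e * (1 / 2 * (1 / 2) ^ j e) ^ (d / p.toReal)) ≤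
      ⨆ (h : Fin d → ℝ) (_ : ‖h‖ ≤ (1 / 2) ^ j e), eLpNorm (iterDiff M (restrictLast N d
        (glueFn ⟨0, by omega⟩ (2 * M + 2) (fun e z => A e * φ ((2 : ℝ) ^ j e •
          (z - ctr N d ((2 * M + 2) * e) (yc e))))) y) h) p volume := by
  set i0 : Fin N := ⟨0, by omega⟩ with hi0
  set k0 : Fin d := ⟨0, hd⟩ with hk0
  set D : ℝ := 2 * M + 2 with hD
  have hM0 : (0 : ℝ) ≤ M := Nat.cast_nonneg _
  set c : ℤ → Fin N → ℝ := fun e => ctr N d (D * e) (yc e) with hc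
  set G : ℤ → (Fin N → ℝ) → ℝ := fun e z => A e * φ ((2 : ℝ) ^ j e • (z - c e)) with hG
  have hci0 : ∀ e, c e i0 = D * e := fun e => by
    simp only [hc, ctr, hi0]
    rw [dif_pos (by omega), if_pos trivial]
  have hG0 : ∀ (e : ℤ) (z : Fin N → ℝ), 1 / 2 ≤ |z i0 - D * e| → G e z = 0 := fun e z hz =>
    bump_zero φ h0 i0 (j e) (A e) (c e) z (by rw [hci0]; exact hz)
  set τ : ℝ := (1 / 2) ^ j e with hτ
  have hτ0 : 0 < τ := by positivity
  have hτ1 : τ ≤ 1 := pow_le_one₀ (by norm_num) (by norm_num)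
  have hτ2 : (2 : ℝ) ^ j e * τ = 1 := by
    rw [hτ, ← mul_pow]; norm_num
  have hτ3 : 1 / 4 / (2 : ℝ) ^ j e = τ / 4 := by
    rw [hτ, one_div_pow]; ring
  rw [hτ3] at hy
  set h : Fin d → ℝ := fun i => if i = k0 then τ else 0 with hh
  have hhn : ‖h‖ ≤ τ := by
    rw [pi_norm_le_iff_of_nonneg hτ0.le]
    intro i
    simp only [hh]
    split_ifs
    · rw [Real.norm_of_nonneg hτ0.le]
    · simpa using hτ0.le
  refine le_trans ?_ (le_iSup₂ (f := fun (h : Fin d → ℝ) (_ : ‖h‖ ≤ τ) =>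
    eLpNorm (iterDiff M (restrictLast N d (glueFn i0 D G) y) h) p volume) h hhn)
  set xe : Fin d → ℝ := fun i => if i = k0 then D * e - M * τ else 0 with hxe
  have hval : ∀ x ∈ Metric.closedBall xe (τ / 4),
      iterDiff M (restrictLast N d (glueFn i0 D G) y) h x = A e := by
    intro x hx
    rw [Metric.mem_closedBall, dist_eq_norm] at hx
    have hxi : ∀ i, |x i - xe i| ≤ τ / 4 := fun i => (norm_le_pi_norm (x - xe) i).trans hx
    have hloc : ∀ k : ℕ, k ≤ M → restrictLast N d (glueFn i0 D G) y (x + (k : ℝ) • h) =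
        G e (fun i => if h' : (i : ℕ) < d then (x + (k : ℝ) • h) ⟨i, h'⟩ else
          y ⟨(i : ℕ) - d, by have := i.isLt; omega⟩) := by
      intro k hk
      unfold restrictLast
      apply glueFn_local i0 D (by rw [hD]; linarith) G hG0
      simp only [hi0]
      rw [dif_pos (by omega)]
      have hkM : (k : ℝ) ≤ M := by exact_mod_cast hk
      have := hxi k0
      simp only [hxe, if_true] at this
      have e1 : (x + (k : ℝ) • h) k0 - D * e = (x k0 - (D * e - M * τ)) - (M - k) * τ := by
        simp [hh]; ring
      change |(x + (k : ℝ) • h) k0 - D * e| ≤ D - 1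
      rw [e1]
      refine (abs_sub _ _).trans ?_
      rw [abs_of_nonneg (a := ((M : ℝ) - k) * τ) (mul_nonneg (by linarith) hτ0.le)]
      have : ((M : ℝ) - k) * τ ≤ M * 1 := by
        apply mul_le_mul _ hτ1 hτ0.le hM0
        have : (0 : ℝ) ≤ k := Nat.cast_nonneg _
        linarith
      rw [hD]; linarith
    rw [iterDiff, Finset.sum_range_succ, Finset.sum_eq_zero, zero_add, hloc M le_rfl]
    · simp only [hG]
      rw [hφ1]
      · simp
      · rw [norm_smul, norm_pow, Real.norm_ofNat]
        have : ‖(fun i : Fin N => if h' : (i : ℕ) < d then (x + (M : ℝ) • h) ⟨i, h'⟩ else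
          y ⟨(i : ℕ) - d, by have := i.isLt; omega⟩) - c e‖ ≤ τ / 4 := by
          rw [pi_norm_le_iff_of_nonneg (by positivity)]
          intro i
          simp only [Pi.sub_apply, hc, ctr, Real.norm_eq_abs]
          by_cases hi : (i : ℕ) < d
          · rw [dif_pos hi, dif_pos hi]
            have := hxi ⟨i, hi⟩
            by_cases hi2 : (i : ℕ) = 0
            · have e2 : (⟨i, hi⟩ : Fin d) = k0 := by ext; simp [hk0, hi2]
              rw [e2] at this ⊢
              rw [if_pos hi2]
              simp only [hxe, if_true] at this
              refine le_trans (le_of_eq ?_) this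
              congr 1
              simp [hh]; ring
            · have e2 : (⟨i, hi⟩ : Fin d) ≠ k0 := by
                intro h'; apply hi2; simpa [hk0] using congrArg Fin.val h'
              rw [if_neg hi2]
              simp only [hxe, if_neg e2] at this
              refine le_trans (le_of_eq ?_) this
              congr 1
              simp [hh, e2]
          · rw [dif_neg hi, dif_neg hi]
            exact hy _
        calc _ ≤ (2 : ℝ) ^ j e * (τ / 4) := by gcongr
          _ = 1 / 4 := by rw [← mul_div_assoc, hτ2]
    · intro k hk
      have hkM : k < M := Finset.mem_range.1 hk
      rw [hloc k hkM.le]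
      simp only [hG]
      rw [h0, mul_zero, mul_zero]
      rw [norm_smul, norm_pow, Real.norm_ofNat]
      set z : Fin N → ℝ := (fun i : Fin N => if h' : (i : ℕ) < d then (x + (k : ℝ) • h) ⟨i, h'⟩ else
          y ⟨(i : ℕ) - d, by have := i.isLt; omega⟩) with hz
      have h1 : |z i0 - c e i0| ≤ ‖z - c e‖ := norm_le_pi_norm (z - c e) i0
      have h2 : z i0 = (x + (k : ℝ) • h) k0 := by
        simp only [hz, hi0]
        rw [dif_pos (by omega)]
      have hkM' : (k : ℝ) + 1 ≤ M := by exact_mod_cast hkM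
      have h3 := hxi k0
      simp only [hxe, if_true] at h3
      have e1 : (x + (k : ℝ) • h) k0 - D * e = (x k0 - (D * e - M * τ)) - (M - k) * τ := by
        simp [hh]; ring
      rw [hci0, h2, e1] at h1
      have h4 : τ * (1 / 2) ≤ ‖z - c e‖ := by
        refine le_trans ?_ h1
        rw [le_abs]
        right
        have := (abs_le.1 h3).2
        nlinarith
      calc (1 / 2 : ℝ) = 2 ^ j e * (τ * (1 / 2)) := by rw [← mul_assoc, hτ2, one_mul]
        _ ≤ _ := by gcongr
  have hP : 0 < p.toReal := ENNReal.toReal_pos hp.ne' hpt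
  rw [eLpNorm_eq_lintegral_rpow_enorm_toReal hp.ne' hpt]
  have hball : MeasurableSet (Metric.closedBall xe (τ / 4)) :=
    Metric.isClosed_closedBall.measurableSet
  calc _ = (∫⁻ x in Metric.closedBall xe (τ / 4), ENNReal.ofReal (A e) ^ p.toReal) ^ (1 / p.toReal) := by
        rw [setLIntegral_const, Real.volume_pi_closedBall _ (by positivity),
          ENNReal.mul_rpow_of_nonneg _ _ (by positivity), ← ENNReal.rpow_mul,
          mul_one_div_cancel hP.ne', ENNReal.rpow_one,
          ENNReal.ofReal_rpow_of_nonneg (by positivity) (by positivity),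
          ← ENNReal.ofReal_mul hA, ← Real.rpow_natCast, ← Real.rpow_mul (by positivity),
          Fintype.card_fin]
        congr 3
        · ring
        · ring
    _ ≤ _ := by
        refine ENNReal.rpow_le_rpow ?_ (by positivity)
        refine le_trans ?_ (setLIntegral_le_lintegral (Metric.closedBall xe (τ / 4)) _)
        refine setLIntegral_mono' hball fun x hx => ?_
        rw [hval x hx, ← ofReal_norm, Real.norm_of_nonneg hA]

theorem genBesov_top (d : ℕ) (p q : ℝ≥0∞) (hq0 : 0 < q) (s : ℝ) (hs : 0 < s) (Ψ : ℝ → ℝ)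
    (κ : ℝ) (w b : ℕ → ℝ) (hκ : 0 < κ) (hw : ∀ j, 0 < w j) (hb : ∀ j, 0 < b j)
    (hΨ : ∀ (j : ℕ) (t : ℝ), (1 / 2) ^ j ≤ t → t ≤ 1 → κ * w j ≤ Ψ t)
    (hq1 : q = ⊤ → Tendsto (fun j => b j * w j) atTop atTop)
    (hq2 : q ≠ ⊤ → ∀ j, b j * w j = 1)
    (g : (Fin d → ℝ) → ℝ) (η : ℝ) (hη : 0 < η)
    (hfreq : ∃ᶠ j : ℕ in atTop, ENNReal.ofReal (η * b j * ((2 : ℝ) ^ j) ^ (-s)) ≤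
      ⨆ (h : Fin d → ℝ) (_ : ‖h‖ ≤ (1 / 2) ^ j), eLpNorm (iterDiff (⌊s⌋₊ + 1) g h) p volume) :
    genBesovNorm d p q s Ψ g = ⊤ := by
  rw [genBesovNorm]
  refine ENNReal.add_eq_top.2 (Or.inr ?_)
  have hpow : ∀ j : ℕ, ((1 : ℝ) / 2) ^ j = ((2 : ℝ) ^ j)⁻¹ := fun j => by simp
  by_cases hq : q = ⊤
  · rw [if_pos hq]
    refine ENNReal.eq_top_of_forall_nnreal_le fun K => ?_
    have hev : ∀ᶠ j in atTop, (K : ℝ) / (η * κ) ≤ b j * w j := (hq1 hq).eventually_ge_atTop _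
    obtain ⟨j, hj1, hj2⟩ := (hfreq.and_eventually hev).exists
    have ht : ((1 : ℝ) / 2) ^ j ∈ Set.Ioc (0 : ℝ) 1 :=
      ⟨by positivity, pow_le_one₀ (by norm_num) (by norm_num)⟩
    refine le_trans ?_ (le_iSup₂ (f := fun (t : ℝ) (_ : t ∈ Set.Ioc (0 : ℝ) 1) =>
      (⨆ (h : Fin d → ℝ) (_ : ‖h‖ ≤ t), eLpNorm (iterDiff (⌊s⌋₊ + 1) g h) p volume) *
          ENNReal.ofReal (Ψ t * t ^ (-s))) _ ht)
    refine le_trans ?_ (mul_le_mul_left hj1 _)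
    have hbj := hb j
    have hwj := hw j
    rw [← ENNReal.ofReal_mul (by positivity), ← ENNReal.ofReal_coe_nnreal]
    apply ENNReal.ofReal_le_ofReal
    have h1 := hΨ j _ le_rfl ht.2
    rw [div_le_iff₀ (by positivity)] at hj2
    calc (K : ℝ) ≤ η * b j * (κ * w j) := by linarith
      _ ≤ η * b j * Ψ ((1 / 2) ^ j) := by gcongr
      _ = _ := by
        rw [hpow, Real.inv_rpow (by positivity)]
        have : ((2 : ℝ) ^ j) ^ (-s) ≠ 0 := by positivity
        field_simp
  · rw [if_neg hq]
    set Q := q.toReal with hQ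
    have hQ0 : 0 < Q := ENNReal.toReal_pos hq0.ne' hq
    refine ENNReal.rpow_eq_top_iff.2 (Or.inr ⟨?_, by positivity⟩)
    set Φ : ℝ → ℝ≥0∞ := fun t => (⨆ (h : Fin d → ℝ) (_ : ‖h‖ ≤ t),
      eLpNorm (iterDiff (⌊s⌋₊ + 1) g h) p volume) ^ Q *
        ENNReal.ofReal (Ψ t ^ Q * t ^ (-1 - s * Q)) with hΦ
    by_contra hne
    set I : ℕ → Set ℝ := fun j => Set.Ioc ((1 / 2 : ℝ) ^ (j + 1)) ((1 / 2) ^ j) with hI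
    have hdisj : Pairwise (Function.onFun Disjoint I) := by
      have : Antitone (fun j : ℕ => (1 / 2 : ℝ) ^ j) :=
        fun a b hab => pow_le_pow_of_le_one (by norm_num) (by norm_num) hab
      exact this.pairwise_disjoint_on_Ioc_succ
    have hsub : (⋃ j, I j) ⊆ Set.Ioc (0 : ℝ) 1 := by
      refine Set.iUnion_subset fun j t ht => ⟨?_, ?_⟩
      · exact lt_trans (by positivity) ht.1
      · exact ht.2.trans (pow_le_one₀ (by norm_num) (by norm_num))
    have hsum : ∑' j, ∫⁻ t in I j, Φ t ≠ ⊤ := by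
      rw [← lintegral_iUnion (fun j => measurableSet_Ioc) hdisj]
      exact ne_top_of_le_ne_top hne (lintegral_mono_set hsub)
    have hT := ENNReal.tendsto_cofinite_zero_of_tsum_ne_top hsum
    rw [Nat.cofinite_eq_atTop] at hT
    set c0 : ℝ := (η * κ) ^ Q * (2 : ℝ) ^ (-(s * Q)) * (1 / 2) with hc0
    have hc0p : 0 < c0 := by positivity
    have hev := hT.eventually_lt_const (u := ENNReal.ofReal c0) (by simpa using hc0p)
    have hfreq' : ∃ᶠ j : ℕ in atTop, ENNReal.ofReal (η * b (j + 1) * ((2 : ℝ) ^ (j + 1)) ^ (-s)) ≤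
      ⨆ (h : Fin d → ℝ) (_ : ‖h‖ ≤ (1 / 2) ^ (j + 1)),
        eLpNorm (iterDiff (⌊s⌋₊ + 1) g h) p volume := by
      rw [← Filter.map_add_atTop_eq_nat 1, frequently_map] at hfreq
      exact hfreq
    obtain ⟨j, hj1, hj2⟩ := (hfreq'.and_eventually hev).exists
    refine absurd hj2 (not_lt.2 ?_)
    have hbj := hb (j + 1)
    have hwj := hw (j + 1)
    have hbw := hq2 hq (j + 1)
    have hlow : ∀ t ∈ I j, ENNReal.ofReal ((η * b (j + 1) * ((2 : ℝ) ^ (j + 1)) ^ (-s)) ^ Q *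
        ((κ * w (j + 1)) ^ Q * ((1 / 2 : ℝ) ^ j) ^ (-1 - s * Q))) ≤ Φ t := by
      intro t ht
      have ht0 : 0 < t := (show (0 : ℝ) < (1 / 2) ^ (j + 1) by positivity).trans ht.1
      rw [hΦ, ENNReal.ofReal_mul (by positivity)]
      refine mul_le_mul' ?_ (ENNReal.ofReal_le_ofReal ?_)
      · rw [← ENNReal.ofReal_rpow_of_nonneg (by positivity) hQ0.le]
        gcongr
        refine hj1.trans ?_
        refine iSup_mono fun h => ?_
        exact iSup_mono' fun hh => ⟨hh.trans ht.1.le, le_rfl⟩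
      · have h1 := hΨ (j + 1) t ht.1.le (ht.2.trans (pow_le_one₀ (by norm_num) (by norm_num)))
        have h2 : ((1 / 2 : ℝ) ^ j) ^ (-1 - s * Q) ≤ t ^ (-1 - s * Q) := by
          apply Real.rpow_le_rpow_of_nonpos ht0 ht.2
          have : 0 < s * Q := by positivity
          linarith
        have h3 : (κ * w (j + 1)) ^ Q ≤ Ψ t ^ Q := by gcongr
        have h4 : 0 ≤ Ψ t ^ Q := le_trans (by positivity) h3
        exact mul_le_mul h3 h2 (by positivity) h4
    refine le_trans (le_of_eq ?_) (setLIntegral_mono' measurableSet_Ioc hlow)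
    rw [setLIntegral_const, Real.volume_Ioc, ← ENNReal.ofReal_mul (by positivity)]
    congr 1
    have e1 : (1 / 2 : ℝ) ^ j - (1 / 2) ^ (j + 1) = (1 / 2) ^ j * (1 / 2) := by
      rw [pow_succ]; ring
    have e2 : ((1 / 2 : ℝ) ^ j) ^ (-1 - s * Q) = (2 : ℝ) ^ j * ((2 : ℝ) ^ j) ^ (s * Q) := by
      rw [hpow, Real.inv_rpow (by positivity), ← Real.rpow_neg (by positivity), neg_sub,
        sub_neg_eq_add, Real.rpow_add (by positivity), Real.rpow_one, mul_comm]
    have e3 : (η * b (j + 1) * ((2 : ℝ) ^ (j + 1)) ^ (-s)) ^ Q * (κ * w (j + 1)) ^ Q =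
        (η * κ) ^ Q * (((2 : ℝ) ^ j) ^ (-(s * Q)) * (2 : ℝ) ^ (-(s * Q))) := by
      rw [← Real.mul_rpow (by positivity) (by positivity)]
      have : η * b (j + 1) * ((2 : ℝ) ^ (j + 1)) ^ (-s) * (κ * w (j + 1)) =
        (η * κ) * ((2 : ℝ) ^ (j + 1)) ^ (-s) := by
        calc _ = (η * κ) * ((2 : ℝ) ^ (j + 1)) ^ (-s) * (b (j + 1) * w (j + 1)) := by ring
          _ = _ := by rw [hbw, mul_one]
      rw [this, Real.mul_rpow (by positivity) (by positivity), ← Real.rpow_mul (by positivity),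
        pow_succ, Real.mul_rpow (x := (2 : ℝ) ^ j) (y := 2) (by positivity) (by positivity), neg_mul]
    rw [← mul_assoc, e3, e1, e2, hpow, Real.rpow_neg (x := (2 : ℝ) ^ j) (by positivity), hc0]
    have : ((2 : ℝ) ^ j) ^ (s * Q) ≠ 0 := by positivity
    field_simp

/-- Amplitudes of the atoms. -/
noncomputable def amp (n d : ℕ) (P s : ℝ) (b : ℕ → ℝ) (δ : (Fin n → ℤ) → NNReal)
    (W : ℕ → Finset (Fin n → ℕ)) (x : ℕ × (Fin n → ℤ) × (Fin n → ℕ)) : ℝ :=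
  if x.2.2 ∈ W x.1 then
    b x.1 * (δ x.2.1 : ℝ) ^ (1 / P) * ((2 : ℝ) ^ x.1) ^ (-s) * ((2 : ℝ) ^ x.1) ^ (d / P) else 0

theorem amp_nonneg (n d : ℕ) (P s : ℝ) (b : ℕ → ℝ) (hb : ∀ j, 0 < b j)
    (δ : (Fin n → ℤ) → NNReal) (W : ℕ → Finset (Fin n → ℕ))
    (x : ℕ × (Fin n → ℤ) × (Fin n → ℕ)) : 0 ≤ amp n d P s b δ W x := by
  unfold amp
  have := hb x.1
  split_ifs <;> positivity

theorem amp_sum (n d : ℕ) (hn : 1 ≤ n) (P s : ℝ) (hP : 0 < P) (b : ℕ → ℝ) (hb : ∀ j, 0 < b j)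
    (δ : (Fin n → ℤ) → NNReal) (hδ : ∑' v, (δ v : ℝ≥0∞) ≤ 1)
    (W : ℕ → Finset (Fin n → ℕ)) (r : ℕ → ℕ)
    (hW : ∀ j, (W j).card ≤ r j * (2 ^ (j + 1)) ^ (n - 1)) (F : ℕ → ℝ≥0∞) :
    ∑' x : ℕ × (Fin n → ℤ) × (Fin n → ℕ), ‖amp n d P s b δ W x‖ₑ ^ P *
        ENNReal.ofReal (((2 : ℝ) ^ x.1) ^ (n + d))⁻¹ * F x.1 ≤
      ∑' j : ℕ, ENNReal.ofReal (((2 : ℝ) ^ j) ^ (-(s * P))) *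
        (ENNReal.ofReal (2 ^ (n - 1)) * ENNReal.ofReal (b j ^ P * (r j / 2 ^ j))) * F j := by
  rw [ENNReal.tsum_prod']
  refine ENNReal.tsum_le_tsum fun j => ?_
  dsimp only
  rw [ENNReal.tsum_mul_right]
  refine mul_le_mul_left ?_ _
  have hbj := hb j
  set X : ℝ := b j ^ P * ((2 : ℝ) ^ j) ^ (-(s * P)) * ((2 : ℝ) ^ j) ^ d * (((2 : ℝ) ^ j) ^ (n + d))⁻¹
    with hX
  have hX0 : 0 ≤ X := by positivity
  have hpt : ∀ x : (Fin n → ℤ) × (Fin n → ℕ), ‖amp n d P s b δ W (j, x)‖ₑ ^ P *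
        ENNReal.ofReal (((2 : ℝ) ^ j) ^ (n + d))⁻¹ =
      (δ x.1 : ℝ≥0∞) * (if x.2 ∈ W j then ENNReal.ofReal X else 0) := by
    intro x
    rw [← ofReal_norm, Real.norm_of_nonneg (amp_nonneg n d P s b hb δ W _)]
    unfold amp
    dsimp only
    split_ifs with h
    · rw [ENNReal.ofReal_rpow_of_nonneg (by positivity) hP.le, ← ENNReal.ofReal_mul (by positivity),
        ← ENNReal.ofReal_coe_nnreal, ← ENNReal.ofReal_mul (by positivity)]
      congr 1
      rw [Real.mul_rpow (by positivity) (by positivity), Real.mul_rpow (by positivity) (by positivity),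
        Real.mul_rpow (by positivity) (by positivity), ← Real.rpow_mul (by positivity),
        ← Real.rpow_mul (by positivity), ← Real.rpow_mul (by positivity),
        one_div_mul_cancel hP.ne', div_mul_cancel₀ _ hP.ne', Real.rpow_one, Real.rpow_natCast, hX,
        neg_mul]
      ring
    · simp [hP]
  simp_rw [hpt]
  rw [ENNReal.tsum_prod']
  simp_rw [ENNReal.tsum_mul_left]
  change ∑' a : Fin n → ℤ, (δ a : ℝ≥0∞) * (∑' i : Fin n → ℕ,
    if i ∈ W j then ENNReal.ofReal X else 0) ≤ _
  rw [ENNReal.tsum_mul_right]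
  refine (mul_le_mul_left hδ _).trans ?_
  rw [one_mul, tsum_eq_sum (s := W j) (fun w hw => if_neg hw),
    Finset.sum_congr rfl (fun w hw => if_pos hw), Finset.sum_const, nsmul_eq_mul,
    ← ENNReal.ofReal_natCast, ← ENNReal.ofReal_mul (by positivity),
    ← ENNReal.ofReal_mul (by positivity), ← ENNReal.ofReal_mul (by positivity)]
  apply ENNReal.ofReal_le_ofReal
  have hc : ((W j).card : ℝ) ≤ r j * (2 ^ (j + 1)) ^ (n - 1) := by exact_mod_cast hW j
  refine (mul_le_mul_of_nonneg_right hc hX0).trans (le_of_eq ?_)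
  obtain ⟨m, rfl⟩ : ∃ m, n = m + 1 := ⟨n - 1, by omega⟩
  rw [hX, Nat.add_sub_cancel, pow_succ (2 : ℝ) j, mul_pow, pow_add, pow_succ]
  field_simp

theorem seq_unified (p q : ℝ≥0∞) (hp : 0 < p) (hpq : p < q) (w : ℕ → ℝ) (hw : ∀ j, 0 < w j)
    (hw1 : ∀ j, w j ≤ 1) (hdiv : ¬ Summable fun j => w j ^ chiExp p q) :
    ∃ (b : ℕ → ℝ) (r : ℕ → ℕ), (∀ j, 0 < b j) ∧ ¬ Summable (fun j => (r j : ℝ) / 2 ^ j) ∧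
      (q = ⊤ → ∀ j, b j ^ p.toReal * (r j / 2 ^ j) ≤ 1) ∧
      (q = ⊤ → Tendsto (fun j => b j * w j) atTop atTop) ∧
      (q ≠ ⊤ → Summable (fun j => (b j ^ p.toReal * (r j / 2 ^ j)) ^ (q.toReal / p.toReal))) ∧
      (q ≠ ⊤ → ∀ j, b j * w j = 1) := by
  have hP : 0 < p.toReal := ENNReal.toReal_pos hp.ne' hpq.ne_top
  by_cases hq : q = ⊤
  · have he : chiExp p q = p.toReal := by rw [chiExp, if_pos hq]
    obtain ⟨b, r, h1, h2, h3, h4⟩ :=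
      (seq_lemma p.toReal hP (chiExp p q) (by rw [he]; exact hP) w hw hw1 hdiv).1 he
    exact ⟨b, r, h1, h2, fun _ => h3, fun _ => h4, fun h => absurd hq h, fun h => absurd hq h⟩
  · have hPQ : p.toReal < q.toReal := ENNReal.toReal_strict_mono hq hpq
    have he : chiExp p q = q.toReal * p.toReal / (q.toReal - p.toReal) := by
      rw [chiExp, if_neg hq]
    have hpos : 0 < chiExp p q := by
      rw [he]
      exact div_pos (mul_pos (hP.trans hPQ) hP) (by linarith)
    obtain ⟨b, r, h1, h2, h3, h4⟩ :=
      (seq_lemma p.toReal hP (chiExp p q) hpos w hw hw1 hdiv).2 q.toReal hPQ he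
    exact ⟨b, r, h1, h2, fun h => absurd h hq, fun h => absurd h hq, fun _ => h3, fun _ => h4⟩

/-- Theorem 1.7 (optimality): for `0 < p < q ≤ ∞`, `s > σ_p` and an admissible `Ψ` with
`∑_j Ψ(2^{-j})^χ = ∞` (assuming additionally `χ < 1/c_∞` when `q < ∞` and `Ψ` is
increasing), there exists `f ∈ B^s_{p,q}(ℝ^N)` with `f(·,y) ∉ B^{(s,Ψ)}_{p,q}(ℝ^d)` for
a.e. `y ∈ ℝ^{N-d}`. -/
theorem besov_restriction_generalized_smoothness_sharp (N d : ℕ) (hN : 2 ≤ N) (hd : 1 ≤ d)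
    (hdN : d < N) (p q : ℝ≥0∞) (hp : 0 < p) (hpq : p < q)
    (s : ℝ) (hs : sigmaP N p < s)
    (Ψ : ℝ → ℝ) (hΨ : Admissible Ψ)
    (hdiv : ¬ Summable fun j : ℕ => Ψ ((2 : ℝ) ^ (-(j : ℝ))) ^ chiExp p q)
    (hextra : q ≠ ⊤ → MonotoneOn Ψ (Set.Ioc (0 : ℝ) 1) →
      chiExp p q < 1 / sSup ((fun t => Real.logb 2 (Ψ t / Ψ (t ^ 2))) '' Set.Ioc (0 : ℝ) 1)) :
    ∃ f : (Fin N → ℝ) → ℝ, MemBesov N p q s f ∧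
      ∀ᵐ y ∂(MeasureTheory.volume : Measure (Fin (N - d) → ℝ)),
        ¬ MemGenBesov d p q s Ψ (restrictLast N d f y) := by
  have hpt : p ≠ ⊤ := hpq.ne_top
  have hP : 0 < p.toReal := ENNReal.toReal_pos hp.ne' hpt
  have hs0 : 0 < s := lt_of_le_of_lt (mul_nonneg (Nat.cast_nonneg _) (le_max_right _ _)) hs
  obtain ⟨κ, w, hκ, hw, hw1, hwd, hwΨ⟩ := psi_lower Ψ hΨ.1 hΨ.2.1 _ hdiv
  obtain ⟨b, r, hb, hr, hq1, hq2, hq3, hq4⟩ := seq_unified p q hp hpq w hw hw1 hwd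
  have hn : 1 ≤ N - d := by omega
  obtain ⟨W, hW, hcov⟩ := cover_n (N - d) hn r hr
  obtain ⟨δ, hδ0, hδ1⟩ := ENNReal.exists_pos_sum_of_countable (one_ne_zero) (Fin (N - d) → ℤ)
  obtain ⟨φ, hφ, hφc, hφ1, hφ0⟩ := exists_bump N
  have : Nonempty (ℤ ≃ ℕ × (Fin (N - d) → ℤ) × (Fin (N - d) → ℕ)) :=
    nonempty_equiv_of_countable
  obtain ⟨ε⟩ := this
  set M := ⌊s⌋₊ + 1 with hM
  set A : ℤ → ℝ := fun e => amp (N - d) d p.toReal s b δ W (ε e) with hA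
  set J : ℤ → ℕ := fun e => (ε e).1 with hJ
  set yc : ℤ → Fin (N - d) → ℝ := fun e i =>
    ((ε e).2.1 i : ℝ) + (((ε e).2.2 i : ℝ) + 1 / 2) / 2 ^ ((ε e).1 + 1) with hyc
  set i0 : Fin N := ⟨0, by omega⟩ with hi0
  set D : ℝ := 2 * M + 2 with hD
  set f : (Fin N → ℝ) → ℝ := glueFn i0 D (fun e z => A e * φ ((2 : ℝ) ^ J e •
          (z - ctr N d (D * e) (yc e)))) with hf
  refine ⟨f, ?_, ?_⟩
  · obtain ⟨C, hC, hCb⟩ := lintegral_glue M φ hφ hφc hφ0 p.toReal hP i0 D le_rfl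
    obtain ⟨hb1, hb2⟩ := hCb A J (fun e => ctr N d (D * e) (yc e)) (fun e => by
      simp only [ctr, hi0]
      rw [dif_pos (by omega), if_pos trivial])
    have hsum : ∀ F : ℕ → ℝ≥0∞, ∑' e, ‖A e‖ₑ ^ p.toReal * ENNReal.ofReal (((2 : ℝ) ^ J e) ^ N)⁻¹ *
        F (J e) ≤ ∑' j : ℕ, ENNReal.ofReal (((2 : ℝ) ^ j) ^ (-(s * p.toReal))) *
        (ENNReal.ofReal (2 ^ (N - d - 1)) * ENNReal.ofReal (b j ^ p.toReal * (r j / 2 ^ j))) * F j := by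
      intro F
      refine le_trans (le_of_eq ?_)
        (amp_sum (N - d) d hn p.toReal s hP b hb δ hδ1.le W r hW F)
      have hNd : N - d + d = N := by omega
      rw [hNd, ← Equiv.tsum_eq ε]
    refine memBesov_of_bounds N (by omega) p q hp hpq s hs0 f ?_ C hC
      (fun j => ENNReal.ofReal (2 ^ (N - d - 1)) * ENNReal.ofReal (b j ^ p.toReal * (r j / 2 ^ j)))
      ?_ ?_ ?_ ?_
    · refine measurable_glueFn i0 D _ fun e => ?_
      have := hφ.continuous
      exact Continuous.measurable (by fun_prop)
    · refine hb1.trans (mul_le_mul_right ?_ _)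
      simpa using hsum (fun _ => 1)
    · intro h hh
      refine (hb2 h hh).trans (mul_le_mul_right ?_ _)
      exact hsum (fun j => ENNReal.ofReal (min 1 (((2 : ℝ) ^ j * ‖h‖) ^ M)) ^ p.toReal)
    · intro hq
      refine ⟨ENNReal.ofReal (2 ^ (N - d - 1)), ENNReal.ofReal_ne_top, fun j => ?_⟩
      refine (mul_le_mul_right (ENNReal.ofReal_le_ofReal (hq1 hq j)) _).trans ?_
      simp
    · intro hq
      have hQP : 0 ≤ q.toReal / p.toReal := by positivity
      simp_rw [ENNReal.mul_rpow_of_nonneg _ _ hQP]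
      rw [ENNReal.tsum_mul_left]
      refine ENNReal.mul_ne_top (ENNReal.rpow_ne_top_of_nonneg hQP ENNReal.ofReal_ne_top) ?_
      have he : ∀ j, ENNReal.ofReal (b j ^ p.toReal * (r j / 2 ^ j)) ^ (q.toReal / p.toReal) =
          ENNReal.ofReal ((b j ^ p.toReal * (r j / 2 ^ j)) ^ (q.toReal / p.toReal)) := fun j => by
        have := hb j
        exact ENNReal.ofReal_rpow_of_nonneg (by positivity) hQP
      simp_rw [he]
      exact (hq3 hq).tsum_ofReal_ne_top
  · refine Filter.Eventually.of_forall fun y hmem => hmem.2.ne ?_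
    set v : Fin (N - d) → ℤ := fun i => ⌊y i⌋ with hv
    have hδv : 0 < (δ v : ℝ) := by exact_mod_cast hδ0 v
    refine genBesov_top d p q (hp.trans hpq) s hs0 Ψ κ w b hκ hw hb hwΨ hq2 hq4 _
      ((δ v : ℝ) ^ (1 / p.toReal) * (1 / 2) ^ (d / p.toReal)) (by positivity) ?_
    refine (hcov y).mono fun j hj => ?_
    obtain ⟨w', hw', hy⟩ := hj
    set e := ε.symm (j, v, w') with he
    have hεe : ε e = (j, v, w') := by simp [he]
    have hJe : J e = j := by simp [hJ, hεe]
    have hlow := restr_lower N d hd hdN M φ hφ1 hφ0 p hp hpt A J yc e y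
      (by
        intro i
        rw [hJe]
        simp only [hyc, hεe]
        exact hy i)
      (amp_nonneg _ _ _ _ _ hb _ _ _)
    rw [hJe] at hlow
    refine le_trans (le_of_eq ?_) hlow
    congr 1
    have hAe : A e = b j * (δ v : ℝ) ^ (1 / p.toReal) * ((2 : ℝ) ^ j) ^ (-s) *
        ((2 : ℝ) ^ j) ^ (d / p.toReal) := by
      simp only [hA, hεe, amp]
      rw [if_pos hw']
    rw [hAe, Real.mul_rpow (by positivity) (by positivity), one_div_pow (2 : ℝ) j, one_div ((2 : ℝ) ^ j),
      Real.inv_rpow (by positivity)]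
    have : ((2 : ℝ) ^ j) ^ (d / p.toReal) ≠ 0 := by positivity
    field_simp
end

section
/- Let $N \geq 2$, $1 \leq d < N$, $0 < p < q \leq \infty$, $s > \sigma_p := N(1/p-1)_+$, and assume $sp = d$. Then there exists $f \in B^s_{p,q}(\mathbb{R}^N)$ such that $f(\cdot, y) \notin \mathrm{BMO}(\mathbb{R}^d)$ for almost every $y \in \mathbb{R}^{N-d}$. -/
open MeasureTheory
open scoped ENNReal

/-- Membership in `BMO(ℝ^d)`: locally integrable with uniformly bounded mean oscillation
over all balls. -/
def MemBMO {n : ℕ} (g : (Fin n → ℝ) → ℝ) : Prop :=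
  MeasureTheory.LocallyIntegrable g volume ∧
    ∃ C : ℝ, ∀ (z : Fin n → ℝ) (r : ℝ), 0 < r →
      ⨍ x in Metric.ball z r, |g x - ⨍ w in Metric.ball z r, g w| ≤ C

/-! ### Smooth functions: bounds of iterated differences -/

lemma brn_fderiv_fwdDiff {E F : Type} [NormedAddCommGroup E] [NormedSpace ℝ E]
    [NormedAddCommGroup F] [NormedSpace ℝ F] (f : E → F) (hf : Differentiable ℝ f) (u : E)
    (M : ℕ) : Differentiable ℝ ((fwdDiff u)^[M] f) ∧
      fderiv ℝ ((fwdDiff u)^[M] f) = (fwdDiff u)^[M] (fderiv ℝ f) := by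
  induction M with
  | zero => exact ⟨hf, rfl⟩
  | succ M ih =>
    obtain ⟨h1, h2⟩ := ih
    have h3 : Differentiable ℝ (fun z => (fwdDiff u)^[M] f (z + u)) :=
      h1.comp (differentiable_id.add_const u)
    simp only [Function.iterate_succ_apply']
    refine ⟨?_, ?_⟩
    · exact h3.sub h1
    · rw [← h2]
      ext1 z
      have : fwdDiff u ((fwdDiff u)^[M] f) =
        (fun z => (fwdDiff u)^[M] f (z + u)) - (fwdDiff u)^[M] f := rfl
      rw [this, fderiv_sub (h3 z) (h1 z), fderiv_comp_add_right]
      rfl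

lemma brn_fwdDiff_bound {E : Type} [NormedAddCommGroup E] [NormedSpace ℝ E] (M : ℕ) :
    ∀ {F : Type} [NormedAddCommGroup F] [NormedSpace ℝ F] (f : E → F),
      ContDiff ℝ (⊤ : ℕ∞) f → HasCompactSupport f →
      ∃ C : ℝ, 0 ≤ C ∧ ∀ u z, ‖(fwdDiff u)^[M] f z‖ ≤ C * ‖u‖ ^ M := by
  induction M with
  | zero =>
    intro F _ _ f hf hc
    obtain ⟨C, hC⟩ := hc.exists_bound_of_continuous hf.continuous
    exact ⟨max C 0, le_max_right _ _, fun u z => by simpa using Or.inl (hC z)⟩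
  | succ M ih =>
    intro F _ _ f hf hc
    obtain ⟨C, hC0, hC⟩ := ih (fderiv ℝ f) (hf.fderiv_right (by simp)) (hc.fderiv ℝ)
    refine ⟨C, hC0, fun u z => ?_⟩
    obtain ⟨h1, h2⟩ := brn_fderiv_fwdDiff f (hf.differentiable (by simp)) u M
    rw [Function.iterate_succ_apply']
    have := Convex.norm_image_sub_le_of_norm_fderiv_le (𝕜 := ℝ) (f := (fwdDiff u)^[M] f)
      (s := Set.univ) (x := z) (y := z + u) (C := C * ‖u‖ ^ M) (fun x _ => h1 x)
      (fun x _ => by rw [h2]; exact hC u x) convex_univ trivial trivial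
    rw [add_sub_cancel_left] at this
    rw [pow_succ, ← mul_assoc]
    exact this

lemma brn_iterDiff_bound {E : Type} [NormedAddCommGroup E] [NormedSpace ℝ E] (M : ℕ)
    (f : E → ℝ) (hf : ContDiff ℝ (⊤ : ℕ∞) f) (hc : HasCompactSupport f) :
    ∃ C : ℝ, 0 ≤ C ∧ ∀ u z, |iterDiff M f u z| ≤ C * min 1 (‖u‖ ^ M) := by
  obtain ⟨C1, h1, H1⟩ := brn_fwdDiff_bound M f hf hc
  obtain ⟨C2, H2⟩ := hc.exists_bound_of_continuous hf.continuous
  have key : ∀ u z, iterDiff M f u z = (fwdDiff u)^[M] f z := by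
    intro u z
    rw [fwdDiff_iter_eq_sum_shift]
    unfold iterDiff
    refine Finset.sum_congr rfl fun i _ => ?_
    rw [zsmul_eq_mul]
    push_cast
    rw [Nat.cast_smul_eq_nsmul]
  have h3 : ∀ u z, |iterDiff M f u z| ≤ ∑ i ∈ Finset.range (M + 1), (M.choose i : ℝ) * max C2 0 := by
    intro u z
    unfold iterDiff
    refine (Finset.abs_sum_le_sum_abs _ _).trans (Finset.sum_le_sum fun i _ => ?_)
    rw [abs_mul, abs_mul, abs_pow, abs_neg, abs_one, one_pow, one_mul, Nat.abs_cast]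
    exact mul_le_mul_of_nonneg_left ((H2 _).trans (le_max_left _ _)) (Nat.cast_nonneg _)
  set C3 := ∑ i ∈ Finset.range (M + 1), (M.choose i : ℝ) * max C2 0
  refine ⟨max C1 C3, h1.trans (le_max_left _ _), fun u z => ?_⟩
  rcases min_choice 1 (‖u‖ ^ M) with h | h <;> rw [h]
  · rw [mul_one]; exact (h3 u z).trans (le_max_right _ _)
  · rw [key]
    exact (H1 u z).trans (mul_le_mul_of_nonneg_right (le_max_left _ _) (by positivity))

/-! ### Choice of the parameters -/

lemma brn_stage (n : ℕ) (hn : 1 ≤ n) (P r : ℝ) (hr : 1 < r) (k : ℕ) :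
    ∃ m : ℕ, ((k * 2 ^ (m + 1) + 1 : ℕ) : ℝ) ^ n * (((k : ℝ) ^ P * ((1 / 2 : ℝ) ^ m) ^ n) ^ r)
        ≤ (1 / 2) ^ k ∧ (k : ℝ) ^ P * ((1 / 2 : ℝ) ^ m) ^ n ≤ 1 := by
  set A : ℝ := (k : ℝ) ^ P
  have hA : 0 ≤ A := by positivity
  set ρ : ℝ := (1 / 2 : ℝ) ^ n
  have hρ0 : 0 < ρ := by positivity
  have hρ1 : ρ < 1 := pow_lt_one₀ (by norm_num) (by norm_num) (by omega)
  set D : ℝ := (2 * k + 1) ^ n * A ^ r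
  have t1 : Filter.Tendsto (fun m : ℕ => D * (ρ ^ (r - 1)) ^ m) Filter.atTop (nhds (D * 0)) :=
    (tendsto_pow_atTop_nhds_zero_of_lt_one (by positivity)
      (Real.rpow_lt_one hρ0.le hρ1 (by linarith))).const_mul D
  have t2 : Filter.Tendsto (fun m : ℕ => A * ρ ^ m) Filter.atTop (nhds (A * 0)) :=
    (tendsto_pow_atTop_nhds_zero_of_lt_one hρ0.le hρ1).const_mul A
  rw [mul_zero] at t1 t2
  have e1 := t1.eventually (ge_mem_nhds (show (0 : ℝ) < (1 / 2) ^ k by positivity))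
  have e2 := t2.eventually (ge_mem_nhds (show (0 : ℝ) < 1 by norm_num))
  obtain ⟨m, h1, h2⟩ := (e1.and e2).exists
  have hsw : ((1 / 2 : ℝ) ^ m) ^ n = ρ ^ m := by
    rw [← pow_mul, ← pow_mul, mul_comm]
  refine ⟨m, ?_, by rw [hsw]; exact h2⟩
  refine le_trans ?_ h1
  rw [hsw, Real.mul_rpow hA (by positivity)]
  have hb : ((k * 2 ^ (m + 1) + 1 : ℕ) : ℝ) ≤ (2 * k + 1) * 2 ^ m := by
    push_cast
    have : (1 : ℝ) ≤ 2 ^ m := one_le_pow₀ (by norm_num)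
    rw [pow_succ]; linarith
  have hb2 : ((k * 2 ^ (m + 1) + 1 : ℕ) : ℝ) ^ n ≤ (2 * k + 1) ^ n * (ρ ^ m)⁻¹ := by
    refine (pow_le_pow_left₀ (by positivity) hb n).trans (le_of_eq ?_)
    rw [mul_pow, ← hsw, ← inv_pow, ← inv_pow]; norm_num
  have hr' : (ρ ^ m) ^ r = ρ ^ m * (ρ ^ (r - 1)) ^ m := by
    rw [← Real.rpow_natCast (ρ ^ (r - 1)), ← Real.rpow_mul hρ0.le, ← Real.rpow_natCast ρ m,
      ← Real.rpow_mul hρ0.le, ← Real.rpow_add hρ0]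
    congr 1; ring
  calc ((k * 2 ^ (m + 1) + 1 : ℕ) : ℝ) ^ n * (A ^ r * (ρ ^ m) ^ r)
      ≤ ((2 * k + 1) ^ n * (ρ ^ m)⁻¹) * (A ^ r * (ρ ^ m) ^ r) := by gcongr
    _ = D * (ρ ^ (r - 1)) ^ m := by
        rw [hr']
        have : (ρ ^ m)⁻¹ * ρ ^ m = 1 := inv_mul_cancel₀ (by positivity)
        calc _ = (2 * (k:ℝ) + 1) ^ n * A ^ r * (ρ ^ (r - 1)) ^ m * ((ρ ^ m)⁻¹ * ρ ^ m) := by ring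
          _ = _ := by rw [this, mul_one]

lemma brn_params (n : ℕ) (hn : 1 ≤ n) (P r : ℝ) (hP : 0 < P) (hr : 1 < r) :
    ∃ (c l : ℕ → ℝ) (y : ℕ → Fin n → ℝ), (∀ j, 0 ≤ c j) ∧ (∀ j, (1 / 2 : ℝ) ^ j ≤ l j) ∧
      (∀ j, c j ^ P * l j ^ n ≤ 1) ∧
      (∑' j, ENNReal.ofReal (c j ^ P * l j ^ n) ^ r < ⊤) ∧
      ∀ (w : Fin n → ℝ) (C : ℝ), ∃ j, C ≤ c j ∧ ∀ i, |w i - y j i| ≤ l j := by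
  choose m hm1 hm2 using brn_stage n hn P r hr
  let ι := Σ k : ℕ, (Fin n → Fin (k * 2 ^ (m k + 1) + 1))
  obtain ⟨enc, henc⟩ := exists_injective_nat ι
  let lev : ι → ℕ := fun τ => Nat.pair (enc τ) (m τ.1)
  have hlev : Function.Injective lev := by
    intro a b hab
    exact henc (Nat.pair_eq_pair.1 hab).1
  let c0 : ι → ℝ := fun τ => (τ.1 : ℝ)
  let l0 : ι → ℝ := fun τ => (1 / 2) ^ (m τ.1)
  let y0 : ι → Fin n → ℝ := fun τ i => (τ.2 i : ℝ) * (1 / 2) ^ (m τ.1) - τ.1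
  let c := Function.extend lev c0 0
  let l := Function.extend lev l0 1
  let y := Function.extend lev y0 0
  have hc : ∀ τ, c (lev τ) = c0 τ := fun τ => hlev.extend_apply _ _ _
  have hl : ∀ τ, l (lev τ) = l0 τ := fun τ => hlev.extend_apply _ _ _
  have hy : ∀ τ, y (lev τ) = y0 τ := fun τ => hlev.extend_apply _ _ _
  have hc' : ∀ j, (¬ ∃ τ, lev τ = j) → c j = 0 := fun j hj => Function.extend_apply' _ _ _ hj
  have hl' : ∀ j, (¬ ∃ τ, lev τ = j) → l j = 1 := fun j hj => Function.extend_apply' _ _ _ hj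
  refine ⟨c, l, y, ?_, ?_, ?_, ?_, ?_⟩
  · intro j
    by_cases hj : ∃ τ, lev τ = j
    · obtain ⟨τ, rfl⟩ := hj
      rw [hc]; exact Nat.cast_nonneg _
    · rw [hc' j hj]
  · intro j
    by_cases hj : ∃ τ, lev τ = j
    · obtain ⟨τ, rfl⟩ := hj
      rw [hl]
      exact pow_le_pow_of_le_one (by norm_num) (by norm_num) (Nat.right_le_pair _ _)
    · rw [hl' j hj]; exact pow_le_one₀ (by norm_num) (by norm_num)
  · intro j
    by_cases hj : ∃ τ, lev τ = j
    · obtain ⟨τ, rfl⟩ := hj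
      rw [hl, hc]
      exact hm2 τ.1
    · rw [hl' j hj, hc' j hj, Real.zero_rpow hP.ne']; norm_num
  · set g : ℕ → ℝ≥0∞ := fun j => ENNReal.ofReal (c j ^ P * l j ^ n) ^ r with hg
    have hsupp : Function.support g ⊆ Set.range lev := by
      intro j hj
      by_contra hcon
      apply hj
      have hcon' : ¬ ∃ τ, lev τ = j := hcon
      simp only [hg]
      rw [hl' j hcon', hc' j hcon', Real.zero_rpow hP.ne', zero_mul, ENNReal.ofReal_zero,
        ENNReal.zero_rpow_of_pos (by linarith)]
    have h1 : ∑' j, g j = ∑' τ, g (lev τ) := (hlev.tsum_eq hsupp).symm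
    rw [h1]
    have h2 : ∀ τ : ι, g (lev τ) =
        (fun (k : ℕ) (_ : Fin n → Fin (k * 2 ^ (m k + 1) + 1)) =>
          ENNReal.ofReal ((k : ℝ) ^ P * ((1 / 2 : ℝ) ^ (m k)) ^ n) ^ r) τ.1 τ.2 := by
      intro τ
      simp only [hg]
      rw [hc, hl]
    rw [tsum_congr h2]
    refine lt_of_eq_of_lt (ENNReal.tsum_sigma
      (fun (k : ℕ) (_ : Fin n → Fin (k * 2 ^ (m k + 1) + 1)) =>
          ENNReal.ofReal ((k : ℝ) ^ P * ((1 / 2 : ℝ) ^ (m k)) ^ n) ^ r)) ?_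
    have h3 : ∀ k : ℕ, ∑' _ : Fin n → Fin (k * 2 ^ (m k + 1) + 1),
        ENNReal.ofReal ((k : ℝ) ^ P * ((1 / 2 : ℝ) ^ (m k)) ^ n) ^ r ≤
          ENNReal.ofReal ((1 / 2) ^ k) := by
      intro k
      rw [tsum_fintype, Finset.sum_const, Finset.card_univ, Fintype.card_fun, Fintype.card_fin,
        Fintype.card_fin, nsmul_eq_mul, ENNReal.ofReal_rpow_of_nonneg (by positivity) (by linarith),
        ← ENNReal.ofReal_natCast, ← ENNReal.ofReal_mul (by positivity)]
      apply ENNReal.ofReal_le_ofReal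
      have := hm1 k
      push_cast at this ⊢
      exact this
    refine (ENNReal.tsum_le_tsum h3).trans_lt ?_
    exact Summable.tsum_ofReal_lt_top (summable_geometric_of_lt_one (by norm_num) (by norm_num))
  · intro w C
    obtain ⟨k, hk⟩ := exists_nat_ge (max C ‖w‖)
    have hkC : C ≤ k := (le_max_left _ _).trans hk
    have hkw : ∀ i, |w i| ≤ k := fun i => (norm_le_pi_norm w i).trans ((le_max_right _ _).trans hk)
    have hpos : (0 : ℝ) < 2 ^ (m k) := by positivity
    have hx0 : ∀ i, 0 ≤ (w i + k) * 2 ^ (m k) := fun i =>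
      mul_nonneg (by linarith [(abs_le.1 (hkw i)).1]) hpos.le
    have hbd : ∀ i, ⌊(w i + k) * 2 ^ (m k)⌋₊ < k * 2 ^ (m k + 1) + 1 := by
      intro i
      rw [Nat.lt_succ_iff]
      apply Nat.floor_le_of_le
      push_cast
      rw [pow_succ]
      nlinarith [(abs_le.1 (hkw i)).2]
    let τ : ι := ⟨k, fun i => ⟨⌊(w i + k) * 2 ^ (m k)⌋₊, hbd i⟩⟩
    refine ⟨lev τ, by rw [hc]; exact hkC, fun i => ?_⟩
    rw [hy, hl]
    show |w i - ((⌊(w i + k) * 2 ^ (m k)⌋₊ : ℝ) * (1 / 2) ^ (m k) - k)| ≤ (1 / 2) ^ (m k)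
    have f1 := Nat.floor_le (hx0 i)
    have f2 := (Nat.lt_floor_add_one ((w i + k) * 2 ^ (m k))).le
    have hinv : (2 : ℝ) ^ (m k) * (1 / 2) ^ (m k) = 1 := by rw [← mul_pow]; norm_num
    have hpos' : (0 : ℝ) < (1 / 2) ^ (m k) := by positivity
    have g1 := mul_le_mul_of_nonneg_right f1 hpos'.le
    have g2 := mul_le_mul_of_nonneg_right f2 hpos'.le
    rw [mul_assoc, hinv] at g1
    rw [mul_assoc, hinv] at g2
    rw [abs_le]; constructor <;> linarith

/-! ### The kernel `exp (-η |log t|)` -/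

lemma brn_kernel_sum (η : ℝ) (hη : 0 < η) : ∃ C : ℝ≥0∞, C < ⊤ ∧ ∀ x : ℝ, 0 < x →
    ∑' j : ℕ, ENNReal.ofReal (Real.exp (-η * |Real.log (2 ^ j * x)|)) ≤ C := by
  have hl2 : 0 < Real.log 2 := Real.log_pos (by norm_num)
  set a : ℝ := η * Real.log 2 with ha
  have hapos : 0 < a := by positivity
  set g : ℤ → ℝ := fun m => Real.exp a * Real.exp (-a * |(m : ℝ)|) with hg
  have hsum : Summable g := by
    apply Summable.mul_left
    have h0 : Summable (fun n : ℕ => Real.exp (n * (-a))) :=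
      Real.summable_exp_nat_mul_iff.2 (by linarith)
    apply Summable.of_nat_of_neg
    · refine h0.congr fun n => ?_
      simp [mul_comm]
    · refine h0.congr fun n => ?_
      simp [mul_comm]
  refine ⟨∑' m, ENNReal.ofReal (g m), hsum.tsum_ofReal_lt_top, fun x hx => ?_⟩
  set k : ℤ := ⌊Real.log x / Real.log 2⌋ with hk
  have hinj : Function.Injective (fun j : ℕ => (j : ℤ) + k) := by
    intro i j hij
    simpa using hij
  refine le_trans (ENNReal.tsum_le_tsum fun j => ?_)
    (ENNReal.tsum_comp_le_tsum_of_injective hinj (fun m => ENNReal.ofReal (g m)))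
  apply ENNReal.ofReal_le_ofReal
  simp only [hg]
  rw [← Real.exp_add, Real.exp_le_exp, Real.log_mul (by positivity) hx.ne', Real.log_pow]
  have h1 := Int.floor_le (Real.log x / Real.log 2)
  have h2 := (Int.lt_floor_add_one (Real.log x / Real.log 2)).le
  rw [← hk] at h1 h2
  rw [le_div_iff₀ hl2] at h1
  rw [div_le_iff₀ hl2] at h2
  have h3 : |((j : ℤ) + k : ℤ)| * Real.log 2 ≤ |(j : ℝ) * Real.log 2 + Real.log x| + Real.log 2 := by
    push_cast
    rw [show |(j : ℝ) + k| * Real.log 2 = |((j : ℝ) + k) * Real.log 2| by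
      rw [abs_mul, abs_of_pos hl2]]
    have : ((j : ℝ) + k) * Real.log 2 = (j * Real.log 2 + Real.log x) +
      (k * Real.log 2 - Real.log x) := by ring
    rw [this]
    refine (abs_add_le _ _).trans (add_le_add_right ?_ _)
    rw [abs_le]; constructor <;> linarith
  have := mul_le_mul_of_nonneg_left h3 hη.le
  push_cast at this ⊢
  rw [ha]
  nlinarith

lemma brn_kernel_integrable (N : ℕ) (hN : 1 ≤ N) (η : ℝ) (hη : 0 < η) :
    Integrable (fun h : Fin N → ℝ => Real.exp (-η * |Real.log ‖h‖|) * ‖h‖ ^ (-(N : ℝ))) := by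
  have : Nonempty (Fin N) := ⟨⟨0, hN⟩⟩
  rw [integrable_fun_norm_addHaar volume
    (f := fun y : ℝ => Real.exp (-η * |Real.log y|) * y ^ (-(N : ℝ)))]
  have hfr : Module.finrank ℝ (Fin N → ℝ) = N := by simp
  rw [hfr]
  have hsimp : ∀ y : ℝ, 0 < y → y ^ (N - 1) • (Real.exp (-η * |Real.log y|) * y ^ (-(N : ℝ))) =
      Real.exp (-η * |Real.log y|) * y ^ (-1 : ℝ) := by
    intro y hy
    have : y ^ (N - 1) * y ^ (-(N : ℝ)) = y ^ (-1 : ℝ) := by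
      rw [← Real.rpow_natCast, ← Real.rpow_add hy, Nat.cast_sub hN]
      congr 1; push_cast; ring
    rw [smul_eq_mul, ← this]; ring
  rw [← Set.Ioc_union_Ioi_eq_Ioi (zero_le_one (α := ℝ)), integrableOn_union]
  constructor
  · have h0 : IntegrableOn (fun y : ℝ => y ^ (η - 1)) (Set.Ioc 0 1) := by
      have := intervalIntegral.intervalIntegrable_rpow' (a := 0) (b := 1) (r := η - 1) (by linarith)
      rwa [intervalIntegrable_iff_integrableOn_Ioc_of_le zero_le_one] at this
    refine h0.congr_fun (fun y hy => ?_) measurableSet_Ioc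
    dsimp only
    rw [hsimp y hy.1, abs_of_nonpos (Real.log_nonpos hy.1.le hy.2), Real.rpow_def_of_pos hy.1,
      Real.rpow_def_of_pos hy.1, ← Real.exp_add]
    congr 1; ring
  · have h0 : IntegrableOn (fun y : ℝ => y ^ (-η - 1)) (Set.Ioi 1) :=
      integrableOn_Ioi_rpow_of_lt (by linarith) one_pos
    refine h0.congr_fun (fun y hy => ?_) measurableSet_Ioi
    have hy0 : (0 : ℝ) < y := lt_trans one_pos hy
    dsimp only
    rw [hsimp y hy0, abs_of_nonneg (Real.log_nonneg (le_of_lt hy)), Real.rpow_def_of_pos hy0,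
      Real.rpow_def_of_pos hy0, ← Real.exp_add]
    congr 1; ring

lemma brn_kernel_int (N : ℕ) (hN : 1 ≤ N) (η : ℝ) (hη : 0 < η) : ∃ C : ℝ≥0∞, C < ⊤ ∧
    ∀ R : ℝ, 0 < R → ∫⁻ h : Fin N → ℝ,
      ENNReal.ofReal (Real.exp (-η * |Real.log (R * ‖h‖)|) * ‖h‖ ^ (-(N : ℝ))) ≤ C := by
  set F : (Fin N → ℝ) → ℝ := fun h => Real.exp (-η * |Real.log ‖h‖|) * ‖h‖ ^ (-(N : ℝ)) with hF
  have hint : Integrable F := brn_kernel_integrable N hN η hη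
  refine ⟨ENNReal.ofReal (∫ h, F h), ENNReal.ofReal_lt_top, fun R hR => ?_⟩
  have h1 : ∀ h : Fin N → ℝ, Real.exp (-η * |Real.log (R * ‖h‖)|) * ‖h‖ ^ (-(N : ℝ)) =
      R ^ N * F (R • h) := by
    intro h
    simp only [hF]
    rw [norm_smul, Real.norm_eq_abs, abs_of_pos hR, Real.mul_rpow hR.le (norm_nonneg _),
      Real.rpow_neg hR.le, Real.rpow_natCast]
    field_simp
  simp only [h1]
  rw [← ofReal_integral_eq_lintegral_ofReal]
  · rw [integral_const_mul, Measure.integral_comp_smul]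
    apply ENNReal.ofReal_le_ofReal
    have : Module.finrank ℝ (Fin N → ℝ) = N := by simp
    rw [this, abs_of_pos (by positivity), smul_eq_mul, ← mul_assoc, mul_inv_cancel₀ (by positivity),
      one_mul]
  · exact (hint.comp_smul hR.ne').const_mul _
  · refine Filter.Eventually.of_forall fun h => ?_
    simp only [hF, Pi.zero_apply]
    positivity

/-- The discrete Young-type inequality. -/
lemma brn_young (a k : ℕ → ℝ≥0∞) (r : ℝ) (hr : 1 < r) :
    (∑' j, a j * (k j * k j)) ^ r ≤ (∑' j, k j) ^ r * ∑' j, a j ^ r * k j ^ r := by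
  have hr0 : 0 < r := by linarith
  have h1 : ∀ j, a j * k j ≤ (∑' j, a j ^ r * k j ^ r) ^ (1 / r) := by
    intro j
    rw [one_div, ENNReal.le_rpow_inv_iff hr0, ENNReal.mul_rpow_of_nonneg _ _ hr0.le]
    exact ENNReal.le_tsum (f := fun j => a j ^ r * k j ^ r) j
  set S := ∑' j, a j ^ r * k j ^ r
  have h2 : ∑' j, a j * (k j * k j) ≤ (∑' j, k j) * S ^ (1 / r) := by
    rw [← ENNReal.tsum_mul_right]
    refine ENNReal.tsum_le_tsum fun j => ?_
    calc a j * (k j * k j) = k j * (a j * k j) := by ring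
      _ ≤ _ := by gcongr; exact h1 j
  calc _ ≤ ((∑' j, k j) * S ^ (1 / r)) ^ r := ENNReal.rpow_le_rpow h2 hr0.le
    _ = _ := by
      rw [ENNReal.mul_rpow_of_nonneg _ _ hr0.le, ← ENNReal.rpow_mul, one_div_mul_cancel hr0.ne',
        ENNReal.rpow_one]

/-- The kernel comparison. -/
lemma brn_kernel_le (t D P δ : ℝ) (M : ℕ) (ht : 0 < t) (hP : 0 < P) (h1 : δ ≤ D)
    (h2 : δ ≤ M * P - D) :
    t ^ (-D) * (min 1 (t ^ M)) ^ P ≤ Real.exp (-δ * |Real.log t|) := by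
  rcases le_total 1 t with h | h
  · have hl := Real.log_nonneg h
    have : min 1 (t ^ M) ≤ 1 := min_le_left _ _
    have h3 : (min 1 (t ^ M)) ^ P ≤ 1 := Real.rpow_le_one (by positivity) this hP.le
    calc t ^ (-D) * (min 1 (t ^ M)) ^ P ≤ t ^ (-D) * 1 := by gcongr
      _ ≤ _ := by
        rw [mul_one, Real.rpow_def_of_pos ht, Real.exp_le_exp, abs_of_nonneg hl]; nlinarith
  · have hl := Real.log_nonpos ht.le h
    have : min 1 (t ^ M) ≤ t ^ M := min_le_right _ _
    have h3 : (min 1 (t ^ M)) ^ P ≤ (t ^ M) ^ P := Real.rpow_le_rpow (by positivity) this hP.le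
    calc t ^ (-D) * (min 1 (t ^ M)) ^ P ≤ t ^ (-D) * (t ^ M) ^ P := by gcongr
      _ ≤ _ := by
        rw [← Real.rpow_natCast, ← Real.rpow_mul ht.le, ← Real.rpow_add ht,
          Real.rpow_def_of_pos ht, Real.exp_le_exp, abs_of_nonpos hl]; nlinarith

/-! ### The building blocks -/

/-- A rescaled bump. -/
noncomputable def brnPiece {N : ℕ} (Φ : (Fin N → ℝ) → ℝ) (c : ℝ) (lam ζ : Fin N → ℝ) (z : Fin N → ℝ) : ℝ :=
  c * Φ (fun i => lam i * (z i - ζ i))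

lemma brnPiece_iterDiff {N : ℕ} (Φ : (Fin N → ℝ) → ℝ) (c : ℝ) (lam ζ : Fin N → ℝ) (M : ℕ)
    (h z : Fin N → ℝ) : iterDiff M (brnPiece Φ c lam ζ) h z =
      c * iterDiff M Φ (fun i => lam i * h i) (fun i => lam i * (z i - ζ i)) := by
  unfold iterDiff brnPiece
  rw [Finset.mul_sum]
  refine Finset.sum_congr rfl fun k _ => ?_
  have : (fun i => lam i * ((z + (k : ℝ) • h) i - ζ i)) =
      (fun i => lam i * (z i - ζ i)) + (k : ℝ) • (fun i => lam i * h i) := by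
    ext i
    simp only [Pi.add_apply, Pi.smul_apply, smul_eq_mul]
    ring
  rw [this]
  ring

lemma brnPiece_supp {N : ℕ} (Φ : (Fin N → ℝ) → ℝ) (hΦ : ∀ x, 2 ≤ ‖x‖ → Φ x = 0) (c : ℝ)
    (lam ζ : Fin N → ℝ) (hlam : ∀ i, 0 < lam i) (z : Fin N → ℝ)
    (hz : brnPiece Φ c lam ζ z ≠ 0) (i : Fin N) : |z i - ζ i| ≤ 2 / lam i := by
  have h1 : ‖(fun i => lam i * (z i - ζ i))‖ < 2 := by
    by_contra hcon
    apply hz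
    unfold brnPiece
    rw [hΦ _ (not_lt.1 hcon), mul_zero]
  have h2 := (norm_le_pi_norm (fun i => lam i * (z i - ζ i)) i).trans h1.le
  rw [Real.norm_eq_abs, abs_mul, abs_of_pos (hlam i)] at h2
  rw [le_div_iff₀ (hlam i)]
  linarith

lemma brnPiece_lintegral {N : ℕ} (Φ : (Fin N → ℝ) → ℝ) (hΦ : ∀ x, 2 ≤ ‖x‖ → Φ x = 0) (c : ℝ)
    (hc : 0 ≤ c) (lam ζ : Fin N → ℝ) (hlam : ∀ i, 0 < lam i) (R : ℝ) (hR : ∀ i, lam i ≤ R)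
    (hR0 : 0 ≤ R) (M : ℕ) (C₀ : ℝ) (hC₀ : 0 ≤ C₀)
    (hb : ∀ u z, |iterDiff M Φ u z| ≤ C₀ * min 1 (‖u‖ ^ M)) (P : ℝ) (hP : 0 < P)
    (h : Fin N → ℝ) :
    ∫⁻ z, ‖iterDiff M (brnPiece Φ c lam ζ) h z‖ₑ ^ P ≤
      ENNReal.ofReal ((M + 1) * (c * (C₀ * min 1 ((R * ‖h‖) ^ M))) ^ P * ∏ i, (4 / lam i)) := by
  set S : Set (Fin N → ℝ) := Set.Icc (fun i => ζ i - 2 / lam i) (fun i => ζ i + 2 / lam i) with hS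
  have hvol : volume S = ENNReal.ofReal (∏ i, (4 / lam i)) := by
    rw [hS, Real.volume_Icc_pi, ENNReal.ofReal_prod_of_nonneg
      (fun i _ => (div_pos (by norm_num) (hlam i)).le)]
    refine Finset.prod_congr rfl fun i _ => ?_
    congr 1; ring
  set B : ℝ := c * (C₀ * min 1 ((R * ‖h‖) ^ M)) with hB
  have hB0 : 0 ≤ B := by positivity
  have hbB : ∀ z, |iterDiff M (brnPiece Φ c lam ζ) h z| ≤ B := by
    intro z
    rw [brnPiece_iterDiff, abs_mul, abs_of_nonneg hc]
    refine mul_le_mul_of_nonneg_left ((hb _ _).trans ?_) hc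
    refine mul_le_mul_of_nonneg_left ?_ hC₀
    refine min_le_min_left _ (pow_le_pow_left₀ (norm_nonneg _) ?_ M)
    rw [pi_norm_le_iff_of_nonneg (by positivity)]
    intro i
    rw [Real.norm_eq_abs, abs_mul, abs_of_pos (hlam i)]
    exact mul_le_mul (hR i) (norm_le_pi_norm h i) (abs_nonneg _) hR0
  have hpt : ∀ z, ‖iterDiff M (brnPiece Φ c lam ζ) h z‖ₑ ^ P ≤
      ∑ k ∈ Finset.range (M + 1),
        S.indicator (fun _ => ENNReal.ofReal (B ^ P)) (z + (k : ℝ) • h) := by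
    intro z
    by_cases hz : ∃ k ∈ Finset.range (M + 1), z + (k : ℝ) • h ∈ S
    · obtain ⟨k, hk, hkS⟩ := hz
      refine le_trans ?_ (Finset.single_le_sum (fun _ _ => zero_le) hk)
      rw [Set.indicator_of_mem hkS, ← ENNReal.ofReal_rpow_of_nonneg hB0 hP.le]
      refine ENNReal.rpow_le_rpow ?_ hP.le
      rw [Real.enorm_eq_ofReal_abs]
      exact ENNReal.ofReal_le_ofReal (hbB z)
    · have : iterDiff M (brnPiece Φ c lam ζ) h z = 0 := by
        unfold iterDiff
        refine Finset.sum_eq_zero fun k hk => ?_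
        have : brnPiece Φ c lam ζ (z + (k : ℝ) • h) = 0 := by
          by_contra hne
          apply hz
          refine ⟨k, hk, ?_⟩
          have := brnPiece_supp Φ hΦ c lam ζ hlam _ hne
          refine ⟨fun i => ?_, fun i => ?_⟩
          · have := (abs_le.1 (this i)).1
            dsimp only at *
            linarith
          · have := (abs_le.1 (this i)).2
            dsimp only at *
            linarith
        rw [this, mul_zero]
      rw [this, enorm_zero, ENNReal.zero_rpow_of_pos hP]
      exact zero_le
  refine (lintegral_mono hpt).trans ?_
  have hm : Measurable (S.indicator (fun _ => ENNReal.ofReal (B ^ P))) :=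
    measurable_const.indicator measurableSet_Icc
  rw [lintegral_finsetSum]
  swap
  · exact fun k _ => hm.comp (measurable_id.add_const _)
  have : ∀ k ∈ Finset.range (M + 1),
      ∫⁻ z, S.indicator (fun _ => ENNReal.ofReal (B ^ P)) (z + (k : ℝ) • h) =
        ENNReal.ofReal (B ^ P * ∏ i, (4 / lam i)) := by
    intro k _
    rw [lintegral_add_right_eq_self (fun z => S.indicator (fun _ => ENNReal.ofReal (B ^ P)) z),
      lintegral_indicator_const measurableSet_Icc, hvol, ENNReal.ofReal_mul (by positivity)]
  rw [Finset.sum_congr rfl this, Finset.sum_const, Finset.card_range, nsmul_eq_mul,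
    ← ENNReal.ofReal_natCast, ← ENNReal.ofReal_mul (by positivity)]
  apply le_of_eq
  congr 1
  push_cast
  ring

/-- The glued function: at `z` only the piece whose index is nearest to `z i₀ / K` is seen. -/
noncomputable def brnGlue {N : ℕ} (i₀ : Fin N) (K : ℝ) (F : ℕ → (Fin N → ℝ) → ℝ) (z : Fin N → ℝ) : ℝ :=
  F ⌊z i₀ / K + 1 / 2⌋₊ z

lemma brn_index (x K : ℝ) (hK : 0 < K) (j : ℕ) (h : |x - K * j| < K / 2) :
    ⌊x / K + 1 / 2⌋₊ = j := by
  rw [abs_lt] at h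
  have h1 : (j : ℝ) - 1 / 2 < x / K := by
    rw [lt_div_iff₀ hK]; linarith
  have h2 : x / K < j + 1 / 2 := by
    rw [div_lt_iff₀ hK]; linarith
  rw [Nat.floor_eq_iff (by linarith [(Nat.cast_nonneg j : (0 : ℝ) ≤ j)])]
  constructor <;> linarith

lemma brnGlue_measurable {N : ℕ} (i₀ : Fin N) (K : ℝ) (F : ℕ → (Fin N → ℝ) → ℝ)
    (hF : ∀ j, Measurable (F j)) : Measurable (brnGlue i₀ K F) := by
  have h1 : Measurable (fun a : ℕ × (Fin N → ℝ) => F a.1 a.2) :=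
    measurable_from_prod_countable_right hF
  have h2 : Measurable (fun z : Fin N → ℝ => (⌊z i₀ / K + 1 / 2⌋₊, z)) := by
    refine Measurable.prodMk ?_ measurable_id
    have h3 : Measurable (fun z : Fin N → ℝ => z i₀ / K + 1 / 2) := by fun_prop
    exact Nat.measurable_floor.comp h3
  exact h1.comp h2

lemma brnGlue_iterDiff {N : ℕ} (i₀ : Fin N) (K : ℝ) (F : ℕ → (Fin N → ℝ) → ℝ) (M : ℕ)
    (hK : 2 * M + 5 ≤ K) (hF : ∀ j z, F j z ≠ 0 → |z i₀ - K * j| ≤ 2) (h z : Fin N → ℝ)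
    (hh : ‖h‖ ≤ 1) : ∃ j, iterDiff M (brnGlue i₀ K F) h z = iterDiff M (F j) h z := by
  refine ⟨⌊z i₀ / K + 1 / 2⌋₊, ?_⟩
  have hM0 : (0 : ℝ) ≤ M := Nat.cast_nonneg _
  have hK0 : 0 < K := by linarith
  unfold iterDiff
  refine Finset.sum_congr rfl fun k hk => ?_
  congr 1
  unfold brnGlue
  set w := z + (k : ℝ) • h with hw
  have hkM : (k : ℝ) ≤ M := by
    have := Finset.mem_range.1 hk
    exact_mod_cast Nat.lt_succ_iff.1 this
  have hwz : |w i₀ - z i₀| ≤ M := by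
    rw [hw, Pi.add_apply, add_sub_cancel_left, Pi.smul_apply, smul_eq_mul, abs_mul, Nat.abs_cast]
    have : |h i₀| ≤ 1 := (norm_le_pi_norm h i₀).trans hh
    calc (k : ℝ) * |h i₀| ≤ M * 1 := by gcongr
      _ = M := mul_one _
  by_cases hj : ⌊w i₀ / K + 1 / 2⌋₊ = ⌊z i₀ / K + 1 / 2⌋₊
  · rw [hj]
  · have e1 : F ⌊z i₀ / K + 1 / 2⌋₊ w = 0 := by
      by_contra hne
      exact hj (brn_index _ K hK0 _ ((hF _ _ hne).trans_lt (by linarith)))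
    have e2 : F ⌊w i₀ / K + 1 / 2⌋₊ w = 0 := by
      by_contra hne
      have h1 := hF _ _ hne
      refine hj (brn_index _ K hK0 _ ?_).symm
      have h2 : z i₀ - K * (⌊w i₀ / K + 1 / 2⌋₊ : ℕ) = (w i₀ - K * (⌊w i₀ / K + 1 / 2⌋₊ : ℕ)) -
        (w i₀ - z i₀) := by ring
      rw [h2]
      refine (abs_sub _ _).trans_lt ?_
      linarith
    rw [e1, e2]

lemma brnGlue_lintegral {N : ℕ} (i₀ : Fin N) (K : ℝ) (F : ℕ → (Fin N → ℝ) → ℝ) (M : ℕ)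
    (hK : 2 * M + 5 ≤ K) (hF : ∀ j z, F j z ≠ 0 → |z i₀ - K * j| ≤ 2)
    (hFm : ∀ j, Measurable (F j)) (P : ℝ) (h : Fin N → ℝ) (hh : ‖h‖ ≤ 1) :
    ∫⁻ z, ‖iterDiff M (brnGlue i₀ K F) h z‖ₑ ^ P ≤ ∑' j, ∫⁻ z, ‖iterDiff M (F j) h z‖ₑ ^ P := by
  rw [← lintegral_tsum]
  · refine lintegral_mono fun z => ?_
    obtain ⟨j, hj⟩ := brnGlue_iterDiff i₀ K F M hK hF h z hh
    rw [hj]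
    exact ENNReal.le_tsum (f := fun j => ‖iterDiff M (F j) h z‖ₑ ^ P) j
  · intro j
    have : Measurable (iterDiff M (F j) h) := by
      unfold iterDiff
      refine Finset.measurable_sum _ fun k _ => ?_
      exact ((hFm j).comp (measurable_id.add_const _)).const_mul _
    exact (this.enorm.pow_const P).aemeasurable

/-! ### The function and its Besov norm -/

/-- Anisotropic scales. -/
noncomputable def brnLam (N d : ℕ) (l : ℕ → ℝ) (j : ℕ) (i : Fin N) : ℝ :=
  if (i : ℕ) < d then 2 ^ j else (l j)⁻¹

/-- Centers. -/
noncomputable def brnZeta (N d : ℕ) (K : ℝ) (y : ℕ → Fin (N - d) → ℝ) (j : ℕ) (i : Fin N) : ℝ :=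
  if h : (i : ℕ) < d then K * j else y j ⟨(i : ℕ) - d, by have := i.isLt; omega⟩

/-- The pieces. -/
noncomputable def brnF (N d : ℕ) (Φ : (Fin N → ℝ) → ℝ) (K : ℝ) (c l : ℕ → ℝ)
    (y : ℕ → Fin (N - d) → ℝ) (j : ℕ) : (Fin N → ℝ) → ℝ :=
  brnPiece Φ (c j) (brnLam N d l j) (brnZeta N d K y j)

lemma brnLam_pos (N d : ℕ) (l : ℕ → ℝ) (hl : ∀ j, (1 / 2 : ℝ) ^ j ≤ l j) (j : ℕ) (i : Fin N) :
    0 < brnLam N d l j i := by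
  have : 0 < l j := lt_of_lt_of_le (by positivity) (hl j)
  unfold brnLam
  split_ifs <;> positivity

lemma brnLam_le (N d : ℕ) (l : ℕ → ℝ) (hl : ∀ j, (1 / 2 : ℝ) ^ j ≤ l j) (j : ℕ) (i : Fin N) :
    brnLam N d l j i ≤ 2 ^ j := by
  unfold brnLam
  split_ifs
  · exact le_rfl
  · refine (inv_anti₀ (by positivity) (hl j)).trans (le_of_eq ?_)
    rw [← inv_pow]; norm_num

lemma brnLam_prod (N d : ℕ) (hdN : d < N) (l : ℕ → ℝ) (j : ℕ) :
    ∏ i, (4 / brnLam N d l j i) = 4 ^ N * ((2 ^ j) ^ d)⁻¹ * l j ^ (N - d) := by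
  have h1 : ∀ i : Fin N, 4 / brnLam N d l j i =
      4 * (if (i : ℕ) < d then (2 ^ j : ℝ)⁻¹ else l j) := by
    intro i
    unfold brnLam
    split_ifs <;> simp [div_eq_mul_inv]
  have hcard : (Finset.univ.filter (fun i : Fin N => (i : ℕ) < d)).card = d := by
    rw [Fin.card_filter_val_lt]; omega
  have hcard2 : (Finset.univ.filter (fun i : Fin N => ¬ (i : ℕ) < d)).card = N - d := by
    have := Finset.card_filter_add_card_filter_not (s := (Finset.univ : Finset (Fin N)))
      (fun i : Fin N => (i : ℕ) < d)
    rw [hcard, Finset.card_univ, Fintype.card_fin] at this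
    omega
  simp only [h1]
  rw [Finset.prod_mul_distrib, Finset.prod_const, Finset.card_univ, Fintype.card_fin,
    Finset.prod_ite, Finset.prod_const, Finset.prod_const, hcard, hcard2, inv_pow, mul_assoc]

lemma brnF_supp (N d : ℕ) (hd : 1 ≤ d) (hdN : d < N) (Φ : (Fin N → ℝ) → ℝ)
    (hΦ : ∀ x, 2 ≤ ‖x‖ → Φ x = 0) (K : ℝ) (c l : ℕ → ℝ)
    (y : ℕ → Fin (N - d) → ℝ) (hl : ∀ j, (1 / 2 : ℝ) ^ j ≤ l j) (j : ℕ) (z : Fin N → ℝ)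
    (hz : brnF N d Φ K c l y j z ≠ 0) : |z ⟨0, by omega⟩ - K * j| ≤ 2 := by
  have := brnPiece_supp Φ hΦ (c j) _ _ (brnLam_pos N d l hl j) z hz ⟨0, by omega⟩
  have hd0 : 0 < d := hd
  simp only [brnLam, brnZeta, hd0, if_true, dif_pos] at this
  refine this.trans ?_
  rw [div_le_iff₀ (by positivity)]
  have : (1 : ℝ) ≤ 2 ^ j := one_le_pow₀ (by norm_num)
  linarith

lemma brnF_measurable (N d : ℕ) (Φ : (Fin N → ℝ) → ℝ) (hΦ : Continuous Φ) (K : ℝ)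
    (c l : ℕ → ℝ) (y : ℕ → Fin (N - d) → ℝ) (j : ℕ) : Measurable (brnF N d Φ K c l y j) := by
  unfold brnF brnPiece
  refine Continuous.measurable (continuous_const.mul (hΦ.comp ?_))
  fun_prop

/-- The counterexample. -/
noncomputable def brnFun (N d : ℕ) (hdN : d < N) (Φ : (Fin N → ℝ) → ℝ) (K : ℝ) (c l : ℕ → ℝ)
    (y : ℕ → Fin (N - d) → ℝ) : (Fin N → ℝ) → ℝ :=
  brnGlue ⟨0, by omega⟩ K (brnF N d Φ K c l y)

lemma brn_core (N d : ℕ) (hd : 1 ≤ d) (hdN : d < N) (Φ : (Fin N → ℝ) → ℝ)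
    (hΦc : Continuous Φ) (hΦ : ∀ x, 2 ≤ ‖x‖ → Φ x = 0) (K : ℝ) (c l : ℕ → ℝ)
    (y : ℕ → Fin (N - d) → ℝ) (hc : ∀ j, 0 ≤ c j) (hl : ∀ j, (1 / 2 : ℝ) ^ j ≤ l j)
    (M : ℕ) (hK : 2 * M + 5 ≤ K) (C₀ : ℝ) (hC₀ : 0 ≤ C₀)
    (hb : ∀ u z, |iterDiff M Φ u z| ≤ C₀ * min 1 (‖u‖ ^ M)) (P : ℝ) (hP : 0 < P)
    (h : Fin N → ℝ) (hh : ‖h‖ ≤ 1) :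
    ∫⁻ z, ‖iterDiff M (brnFun N d hdN Φ K c l y) h z‖ₑ ^ P ≤
      ENNReal.ofReal ((M + 1) * C₀ ^ P * 4 ^ N) * ∑' j : ℕ,
        ENNReal.ofReal ((c j ^ P * l j ^ (N - d)) *
          (((2 : ℝ) ^ j) ^ (-(d : ℝ)) * (min 1 ((2 ^ j * ‖h‖) ^ M)) ^ P)) := by
  refine (brnGlue_lintegral _ K _ M hK (brnF_supp N d hd hdN Φ hΦ K c l y hl)
    (brnF_measurable N d Φ hΦc K c l y) P h hh).trans ?_
  rw [← ENNReal.tsum_mul_left]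
  refine ENNReal.tsum_le_tsum fun j => ?_
  refine (brnPiece_lintegral Φ hΦ (c j) (hc j) _ _ (brnLam_pos N d l hl j) (2 ^ j)
    (brnLam_le N d l hl j) (by positivity) M C₀ hC₀ hb P hP h).trans (le_of_eq ?_)
  rw [← ENNReal.ofReal_mul (by positivity), brnLam_prod N d hdN,
    Real.mul_rpow (hc j) (by positivity), Real.mul_rpow hC₀ (by positivity),
    Real.rpow_neg (by positivity), Real.rpow_natCast]
  congr 1
  ring

lemma brn_core2 (N d : ℕ) (hd : 1 ≤ d) (hdN : d < N) (Φ : (Fin N → ℝ) → ℝ)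
    (hΦc : Continuous Φ) (hΦ : ∀ x, 2 ≤ ‖x‖ → Φ x = 0) (K : ℝ) (c l : ℕ → ℝ)
    (y : ℕ → Fin (N - d) → ℝ) (hc : ∀ j, 0 ≤ c j) (hl : ∀ j, (1 / 2 : ℝ) ^ j ≤ l j)
    (M : ℕ) (hK : 2 * M + 5 ≤ K) (C₀ : ℝ) (hC₀ : 0 ≤ C₀)
    (hb : ∀ u z, |iterDiff M Φ u z| ≤ C₀ * min 1 (‖u‖ ^ M)) (P : ℝ) (hP : 0 < P)
    (η : ℝ) (h1 : η + η ≤ d) (h2 : η + η ≤ M * P - d)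
    (h : Fin N → ℝ) (hh : ‖h‖ ≤ 1) (h0 : h ≠ 0) :
    (∫⁻ z, ‖iterDiff M (brnFun N d hdN Φ K c l y) h z‖ₑ ^ P) *
        ENNReal.ofReal (‖h‖ ^ (-(d : ℝ))) ≤
      ENNReal.ofReal ((M + 1) * C₀ ^ P * 4 ^ N) * ∑' j : ℕ,
        ENNReal.ofReal (c j ^ P * l j ^ (N - d)) *
          (ENNReal.ofReal (Real.exp (-η * |Real.log (2 ^ j * ‖h‖)|)) *
          ENNReal.ofReal (Real.exp (-η * |Real.log (2 ^ j * ‖h‖)|))) := by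
  have hn : 0 < ‖h‖ := norm_pos_iff.2 h0
  refine (mul_le_mul_left (brn_core N d hd hdN Φ hΦc hΦ K c l y hc hl M hK C₀ hC₀ hb P hP h hh)
    _).trans ?_
  rw [mul_assoc, ← ENNReal.tsum_mul_right]
  refine mul_le_mul_right (ENNReal.tsum_le_tsum fun j => ?_) _
  have hlj : 0 < l j := lt_of_lt_of_le (by positivity) (hl j)
  have ha : 0 ≤ c j ^ P * l j ^ (N - d) := mul_nonneg (Real.rpow_nonneg (hc j) _) (by positivity)
  rw [← ENNReal.ofReal_mul (by positivity), ← ENNReal.ofReal_mul (by positivity),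
    ← ENNReal.ofReal_mul ha]
  apply ENNReal.ofReal_le_ofReal
  rw [mul_assoc]
  refine mul_le_mul_of_nonneg_left ?_ ha
  have := brn_kernel_le (2 ^ j * ‖h‖) d P (η + η) M (by positivity) hP h1 h2
  rw [Real.mul_rpow (by positivity) hn.le] at this
  rw [← Real.exp_add]
  refine le_trans (le_of_eq ?_) (this.trans (le_of_eq ?_))
  · ring
  · congr 1; ring

lemma brn_memBesov (N d : ℕ) (hd : 1 ≤ d) (hdN : d < N) (p q : ℝ≥0∞) (hp : 0 < p) (hpt : p ≠ ⊤)
    (s : ℝ) (hsp : s * p.toReal = d) (Φ : (Fin N → ℝ) → ℝ)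
    (hΦs : ContDiff ℝ (⊤ : ℕ∞) Φ) (hΦcs : HasCompactSupport Φ)
    (hΦ : ∀ x, 2 ≤ ‖x‖ → Φ x = 0) (K : ℝ) (c l : ℕ → ℝ)
    (y : ℕ → Fin (N - d) → ℝ) (hc : ∀ j, 0 ≤ c j) (hl : ∀ j, (1 / 2 : ℝ) ^ j ≤ l j)
    (hK : 2 * ((⌊s⌋₊ + 1 : ℕ) : ℝ) + 5 ≤ K)
    (r : ℝ) (hr : 1 < r) (hrq : q ≠ ⊤ → r = q.toReal / p.toReal) (hq0 : q ≠ ⊤ → 0 < q.toReal)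
    (ha1 : ∀ j, c j ^ p.toReal * l j ^ (N - d) ≤ 1)
    (har : ∑' j, ENNReal.ofReal (c j ^ p.toReal * l j ^ (N - d)) ^ r < ⊤) :
    MemBesov N p q s (brnFun N d hdN Φ K c l y) := by
  have hP : 0 < p.toReal := ENNReal.toReal_pos hp.ne' hpt
  set P := p.toReal
  set M := ⌊s⌋₊ + 1 with hM
  have hd0 : (0 : ℝ) < d := by exact_mod_cast hd
  have hs0 : 0 < s := by
    by_contra hcon
    nlinarith [not_lt.1 hcon]
  have hMs : s < M := by rw [hM]; push_cast; exact Nat.lt_floor_add_one s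
  have hr0 : 0 < r := by linarith
  have hΦc := hΦs.continuous
  have hfm : Measurable (brnFun N d hdN Φ K c l y) :=
    brnGlue_measurable _ _ _ (brnF_measurable N d Φ hΦc K c l y)
  refine ⟨hfm.aestronglyMeasurable, ?_⟩
  have hLp : ∀ g : (Fin N → ℝ) → ℝ, eLpNorm g p volume = (∫⁻ z, ‖g z‖ₑ ^ P) ^ (1 / P) :=
    fun g => eLpNorm_eq_lintegral_rpow_enorm_toReal hp.ne' hpt
  unfold besovNorm
  refine ENNReal.add_lt_top.2 ⟨?_, ?_⟩
  · -- the `L^p` norm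
    obtain ⟨C₀, hC₀, hb⟩ := brn_iterDiff_bound 0 Φ hΦs hΦcs
    have hK' : 2 * ((0 : ℕ) : ℝ) + 5 ≤ K := by
      refine le_trans ?_ hK
      have : (0 : ℝ) ≤ M := Nat.cast_nonneg _
      push_cast at this ⊢; linarith
    have h1 := brn_core N d hd hdN Φ hΦc hΦ K c l y hc hl 0 hK' C₀ hC₀ hb P hP 0 (by simp)
    have h2 : ∀ z, iterDiff 0 (brnFun N d hdN Φ K c l y) 0 z = brnFun N d hdN Φ K c l y z := by
      intro z; simp [iterDiff]
    simp only [h2] at h1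
    rw [hLp]
    refine ENNReal.rpow_lt_top_of_nonneg (by positivity) (ne_of_lt (h1.trans_lt ?_))
    refine ENNReal.mul_lt_top ENNReal.ofReal_lt_top ?_
    have h3 : ∀ j : ℕ, ENNReal.ofReal ((c j ^ P * l j ^ (N - d)) *
          (((2 : ℝ) ^ j) ^ (-(d : ℝ)) * (min 1 ((2 ^ j * ‖(0 : Fin N → ℝ)‖) ^ 0)) ^ P)) ≤
        ENNReal.ofReal ((1 / 2) ^ j) := by
      intro j
      apply ENNReal.ofReal_le_ofReal
      rw [pow_zero, min_self, Real.one_rpow, mul_one]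
      have h4 : ((2 : ℝ) ^ j) ^ (-(d : ℝ)) ≤ (1 / 2) ^ j := by
        have h5 : (1 : ℝ) ≤ 2 ^ j := one_le_pow₀ (by norm_num)
        have : ((2 : ℝ) ^ j) ^ (-(d : ℝ)) ≤ ((2 : ℝ) ^ j) ^ (-1 : ℝ) :=
          Real.rpow_le_rpow_of_exponent_le h5 (by
            have : (1 : ℝ) ≤ d := by exact_mod_cast hd
            linarith)
        refine this.trans (le_of_eq ?_)
        rw [Real.rpow_neg_one, ← inv_pow]; norm_num
      calc _ ≤ 1 * ((2 : ℝ) ^ j) ^ (-(d : ℝ)) :=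
            mul_le_mul_of_nonneg_right (ha1 j) (by positivity)
        _ ≤ _ := by rw [one_mul]; exact h4
    refine (ENNReal.tsum_le_tsum h3).trans_lt ?_
    exact Summable.tsum_ofReal_lt_top (summable_geometric_of_lt_one (by norm_num) (by norm_num))
  · obtain ⟨C₀, hC₀, hb⟩ := brn_iterDiff_bound M Φ hΦs hΦcs
    set η : ℝ := min (d : ℝ) (M * P - d) / 2 with hη
    have hMP : 0 < M * P - d := by rw [← hsp]; nlinarith
    have hη0 : 0 < η := by positivity
    have hη1 : η + η ≤ d := by rw [hη, add_halves]; exact min_le_left _ _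
    have hη2 : η + η ≤ M * P - d := by rw [hη, add_halves]; exact min_le_right _ _
    have core := brn_core2 N d hd hdN Φ hΦc hΦ K c l y hc hl M hK C₀ hC₀ hb P hP η hη1 hη2
    set f := brnFun N d hdN Φ K c l y
    set C₁ : ℝ≥0∞ := ENNReal.ofReal ((M + 1) * C₀ ^ P * 4 ^ N) with hC₁
    have hC₁t : C₁ < ⊤ := ENNReal.ofReal_lt_top
    obtain ⟨C₂, hC₂t, hC₂⟩ := brn_kernel_sum η hη0
    have hd_s : (d : ℝ) * (1 / P) = s := by rw [← hsp]; field_simp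
    split_ifs with hq
    · refine lt_of_le_of_lt (b := (C₁ * C₂) ^ (1 / P)) ?_
        (ENNReal.rpow_lt_top_of_nonneg (by positivity) (ENNReal.mul_lt_top hC₁t hC₂t).ne)
      refine iSup₂_le fun h hh => ?_
      by_cases h0 : h = 0
      · rw [h0, norm_zero, Real.zero_rpow (by linarith), ENNReal.ofReal_zero, mul_zero]
        exact zero_le
      have hn : 0 < ‖h‖ := norm_pos_iff.2 h0
      have e1 : ENNReal.ofReal (‖h‖ ^ (-s)) = ENNReal.ofReal (‖h‖ ^ (-(d : ℝ))) ^ (1 / P) := by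
        rw [ENNReal.ofReal_rpow_of_nonneg (by positivity) (by positivity), ← Real.rpow_mul hn.le,
          neg_mul, hd_s]
      rw [hLp, e1, ← ENNReal.mul_rpow_of_nonneg _ _ (by positivity)]
      refine ENNReal.rpow_le_rpow ((core h hh h0).trans ?_) (by positivity)
      refine mul_le_mul_right ((ENNReal.tsum_le_tsum fun j => ?_).trans (hC₂ ‖h‖ hn)) _
      have e2 : ENNReal.ofReal (Real.exp (-η * |Real.log (2 ^ j * ‖h‖)|)) ≤ 1 := by
        rw [ENNReal.ofReal_le_one, Real.exp_le_one_iff]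
        have := abs_nonneg (Real.log (2 ^ j * ‖h‖))
        nlinarith
      have e3 : ENNReal.ofReal (c j ^ P * l j ^ (N - d)) ≤ 1 := ENNReal.ofReal_le_one.2 (ha1 j)
      calc _ ≤ 1 * (1 * ENNReal.ofReal (Real.exp (-η * |Real.log (2 ^ j * ‖h‖)|))) := by gcongr
        _ = _ := by rw [one_mul, one_mul]
    · have hQ := hq0 hq
      have hrQ := hrq hq
      set Q := q.toReal
      obtain ⟨C₃, hC₃t, hC₃⟩ := brn_kernel_int N (by omega) (η * r) (by positivity)
      refine ENNReal.rpow_lt_top_of_nonneg (by positivity) (ne_of_lt ?_)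
      set a : ℕ → ℝ≥0∞ := fun j => ENNReal.ofReal (c j ^ P * l j ^ (N - d)) with ha
      set G : ℕ → (Fin N → ℝ) → ℝ≥0∞ := fun j h =>
        ENNReal.ofReal (Real.exp (-(η * r) * |Real.log (2 ^ j * ‖h‖)|) * ‖h‖ ^ (-(N : ℝ))) with hG
      have hGm : ∀ j, Measurable (G j) := by
        intro j
        simp only [hG]
        have e1 : Measurable (fun h : Fin N → ℝ => |Real.log (2 ^ j * ‖h‖)|) := by
          have : Measurable (fun h : Fin N → ℝ => Real.log (2 ^ j * ‖h‖)) := by fun_prop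
          exact this.abs
        have e2 : Measurable (fun h : Fin N → ℝ => ‖h‖ ^ (-(N : ℝ))) :=
          measurable_norm.pow_const _
        exact ((e1.const_mul _).exp.mul e2).ennreal_ofReal
      have hpt : ∀ h ∈ {h : Fin N → ℝ | ‖h‖ ≤ 1},
          eLpNorm (iterDiff M f h) p volume ^ Q * ENNReal.ofReal (‖h‖ ^ (-(N : ℝ) - s * Q)) ≤
            (C₁ * C₂) ^ r * ∑' j, a j ^ r * G j h := by
        intro h hh
        by_cases h0 : h = 0
        · have : (-(N : ℝ) - s * Q) ≠ 0 := by
            have : (0 : ℝ) ≤ N := Nat.cast_nonneg _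
            nlinarith [mul_pos hs0 hQ]
          rw [h0, norm_zero, Real.zero_rpow this, ENNReal.ofReal_zero, mul_zero]
          exact zero_le
        have hn : 0 < ‖h‖ := norm_pos_iff.2 h0
        have e1 : ENNReal.ofReal (‖h‖ ^ (-(N : ℝ) - s * Q)) =
            ENNReal.ofReal (‖h‖ ^ (-(d : ℝ))) ^ r * ENNReal.ofReal (‖h‖ ^ (-(N : ℝ))) := by
          rw [ENNReal.ofReal_rpow_of_nonneg (by positivity) hr0.le, ← Real.rpow_mul hn.le,
            ← ENNReal.ofReal_mul (by positivity), ← Real.rpow_add hn]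
          congr 2
          rw [hrQ, ← hd_s]
          field_simp
          ring
        rw [hLp, e1, ← ENNReal.rpow_mul, show 1 / P * Q = r by rw [hrQ]; ring, ← mul_assoc,
          ← ENNReal.mul_rpow_of_nonneg _ _ hr0.le]
        have e2 := (ENNReal.rpow_le_rpow (core h hh h0) hr0.le)
        rw [ENNReal.mul_rpow_of_nonneg C₁ _ hr0.le] at e2
        have e3 := brn_young a
          (fun j => ENNReal.ofReal (Real.exp (-η * |Real.log (2 ^ j * ‖h‖)|))) r hr
        have e4 := ENNReal.rpow_le_rpow (hC₂ ‖h‖ hn) hr0.le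
        have e5 := e2.trans (mul_le_mul_right (e3.trans (mul_le_mul_left e4 _)) _)
        refine (mul_le_mul_left e5 _).trans (le_of_eq ?_)
        rw [← mul_assoc, ← ENNReal.mul_rpow_of_nonneg _ _ hr0.le, mul_assoc,
          ← ENNReal.tsum_mul_right]
        congr 1
        refine tsum_congr fun j => ?_
        rw [mul_assoc]
        congr 1
        simp only [hG]
        rw [ENNReal.ofReal_mul (by positivity), ENNReal.ofReal_rpow_of_nonneg (by positivity) hr0.le,
          ← Real.exp_mul]
        congr 3
        ring
      have hms : MeasurableSet {h : Fin N → ℝ | ‖h‖ ≤ 1} :=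
        measurableSet_le measurable_norm measurable_const
      refine (setLIntegral_mono' hms hpt).trans_lt ?_
      refine (setLIntegral_le_lintegral _ _).trans_lt ?_
      rw [lintegral_const_mul _ (Measurable.tsum fun j => (hGm j).const_mul _),
        lintegral_tsum (fun j => ((hGm j).const_mul _).aemeasurable)]
      refine ENNReal.mul_lt_top
        (ENNReal.rpow_lt_top_of_nonneg hr0.le (ENNReal.mul_lt_top hC₁t hC₂t).ne) ?_
      have e6 : ∀ j, ∫⁻ h, a j ^ r * G j h ≤ a j ^ r * C₃ := by
        intro j
        rw [lintegral_const_mul _ (hGm j)]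
        exact mul_le_mul_right (hC₃ (2 ^ j) (by positivity)) _
      refine (ENNReal.tsum_le_tsum e6).trans_lt ?_
      rw [ENNReal.tsum_mul_right]
      exact ENNReal.mul_lt_top har hC₃t

/-! ### Failure of `BMO` on slices -/

lemma brn_osc (d : ℕ) (hd : 1 ≤ d) (g : (Fin d → ℝ) → ℝ) (hg : LocallyIntegrable g volume)
    (x₀ : Fin d → ℝ) (ρ c m : ℝ) (hρ : 0 < ρ)
    (h1 : ∀ x ∈ Metric.ball x₀ ρ, g x = c)
    (h2 : ∀ x ∈ Metric.ball (x₀ + fun _ => 3 * ρ) ρ, g x = 0) :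
    c / 4 ^ d ≤ ⨍ x in Metric.ball x₀ (4 * ρ), |g x - m| := by
  have : Nonempty (Fin d) := ⟨⟨0, hd⟩⟩
  set B := Metric.ball x₀ (4 * ρ) with hB
  set B1 := Metric.ball x₀ ρ with hB1
  set B2 := Metric.ball (x₀ + fun _ => 3 * ρ) ρ with hB2
  have hdist : dist (x₀ + fun _ => 3 * ρ) x₀ = 3 * ρ := by
    rw [dist_eq_norm, add_sub_cancel_left, pi_norm_const, Real.norm_eq_abs,
      abs_of_pos (by positivity)]
  have hs1 : B1 ⊆ B := Metric.ball_subset_ball (by linarith)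
  have hs2 : B2 ⊆ B := Metric.ball_subset_ball' (by rw [hdist]; linarith)
  have hdisj : Disjoint B1 B2 := by
    apply Metric.ball_disjoint_ball
    rw [dist_comm, hdist]; linarith
  have hv : ∀ (a : Fin d → ℝ) (t : ℝ), 0 < t → volume.real (Metric.ball a t) = (2 * t) ^ d := by
    intro a t ht
    rw [measureReal_def, Real.volume_pi_ball a ht, Fintype.card_fin,
      ENNReal.toReal_ofReal (by positivity)]
  have hint : IntegrableOn (fun x => |g x - m|) B := by
    have e1 : IntegrableOn g B :=
      (hg.integrableOn_isCompact (isCompact_closedBall x₀ (4 * ρ))).mono_set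
        Metric.ball_subset_closedBall
    have e2 : IntegrableOn (fun _ : Fin d → ℝ => m) B :=
      integrableOn_const (by rw [hB]; exact measure_ball_lt_top.ne)
    exact (e1.sub e2).abs
  have i1 : ∫ x in B1, |g x - m| = (2 * ρ) ^ d * |c - m| := by
    rw [setIntegral_congr_fun (g := fun _ => |c - m|) measurableSet_ball
      (fun x hx => by dsimp only; rw [h1 x hx]), setIntegral_const, hv _ _ hρ, smul_eq_mul]
  have i2 : ∫ x in B2, |g x - m| = (2 * ρ) ^ d * |m| := by
    rw [setIntegral_congr_fun (g := fun _ => |m|) measurableSet_ball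
      (fun x hx => by dsimp only; rw [h2 x hx, zero_sub, abs_neg]), setIntegral_const, hv _ _ hρ,
      smul_eq_mul]
  have i3 : ∫ x in B1 ∪ B2, |g x - m| ≤ ∫ x in B, |g x - m| :=
    setIntegral_mono_set hint (Filter.Eventually.of_forall fun x => abs_nonneg _)
      (Set.union_subset hs1 hs2).eventuallyLE
  rw [setIntegral_union hdisj measurableSet_ball (hint.mono_set hs1) (hint.mono_set hs2), i1, i2]
    at i3
  rw [setAverage_eq, hv _ _ (by positivity), smul_eq_mul, inv_mul_eq_div,
    div_le_div_iff₀ (by positivity) (by positivity)]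
  have hc : c ≤ |c - m| + |m| := by
    have := le_abs_self (c - m)
    have := le_abs_self m
    linarith
  have e : (2 * (4 * ρ)) ^ d = (2 * ρ) ^ d * 4 ^ d := by rw [← mul_pow]; ring
  rw [e]
  have hV : 0 < (2 * ρ) ^ d := by positivity
  have h4 : (0 : ℝ) < 4 ^ d := by positivity
  calc c * ((2 * ρ) ^ d * 4 ^ d) ≤ (|c - m| + |m|) * ((2 * ρ) ^ d * 4 ^ d) := by gcongr
    _ = ((2 * ρ) ^ d * |c - m| + (2 * ρ) ^ d * |m|) * 4 ^ d := by ring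
    _ ≤ _ := by gcongr

lemma brn_slice (N d : ℕ) (hd : 1 ≤ d) (hdN : d < N) (Φ : (Fin N → ℝ) → ℝ)
    (K : ℝ) (hK : 8 < K) (c l : ℕ → ℝ) (y : ℕ → Fin (N - d) → ℝ) (w : Fin (N - d) → ℝ) (j : ℕ)
    (x : Fin d → ℝ) (hx : |x ⟨0, hd⟩ - K * j| ≤ 4) :
    restrictLast N d (brnFun N d hdN Φ K c l y) w x = c j * Φ (fun i =>
      if h : (i : ℕ) < d then 2 ^ j * (x ⟨i, h⟩ - K * j) else
        (l j)⁻¹ * (w ⟨(i : ℕ) - d, by have := i.isLt; omega⟩ -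
          y j ⟨(i : ℕ) - d, by have := i.isLt; omega⟩)) := by
  have hd0 : 0 < d := hd
  unfold restrictLast brnFun brnGlue
  simp only [hd0, dif_pos]
  rw [brn_index _ K (by linarith) j (hx.trans_lt (by linarith))]
  unfold brnF brnPiece brnLam brnZeta
  congr 2
  ext i
  by_cases hi : (i : ℕ) < d
  · simp only [hi, dif_pos, if_true]
  · simp only [hi, dif_neg, if_false, not_false_eq_true]

lemma brn_notBMO (N d : ℕ) (hd : 1 ≤ d) (hdN : d < N) (Φ : (Fin N → ℝ) → ℝ)
    (hΦ0 : ∀ x, 2 ≤ ‖x‖ → Φ x = 0) (hΦ1 : ∀ x, ‖x‖ ≤ 1 → Φ x = 1)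
    (K : ℝ) (hK : 8 < K) (c l : ℕ → ℝ) (y : ℕ → Fin (N - d) → ℝ)
    (hl : ∀ j, (1 / 2 : ℝ) ^ j ≤ l j)
    (hcov : ∀ (w : Fin (N - d) → ℝ) (C : ℝ), ∃ j, C ≤ c j ∧ ∀ i, |w i - y j i| ≤ l j)
    (w : Fin (N - d) → ℝ) : ¬ MemBMO (restrictLast N d (brnFun N d hdN Φ K c l y) w) := by
  rintro ⟨hloc, C, hC⟩
  obtain ⟨j, hj, hjw⟩ := hcov w (4 ^ d * (C + 1))
  set ρ : ℝ := (1 / 2) ^ j with hρ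
  have hρ0 : 0 < ρ := by positivity
  have hρ1 : ρ ≤ 1 := pow_le_one₀ (by norm_num) (by norm_num)
  have h2ρ : (2 : ℝ) ^ j * ρ = 1 := by rw [hρ, ← mul_pow]; norm_num
  have hlj : 0 < l j := lt_of_lt_of_le (by positivity) (hl j)
  set x₀ : Fin d → ℝ := fun _ => K * j with hx₀
  have key := brn_osc d hd _ hloc x₀ ρ (c j)
    (⨍ u in Metric.ball x₀ (4 * ρ), restrictLast N d (brnFun N d hdN Φ K c l y) w u) hρ0 ?_ ?_
  · have h1 := key.trans (hC x₀ (4 * ρ) (by positivity))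
    rw [div_le_iff₀ (by positivity)] at h1
    have : (0 : ℝ) < 4 ^ d := by positivity
    nlinarith
  · intro x hx
    have hxi : ∀ i, |x i - K * j| ≤ ρ := fun i => by
      have := (dist_le_pi_dist x x₀ i).trans (le_of_lt (Metric.mem_ball.1 hx))
      rwa [Real.dist_eq] at this
    rw [brn_slice N d hd hdN Φ K hK c l y w j x ((hxi _).trans (by linarith)), hΦ1, mul_one]
    rw [pi_norm_le_iff_of_nonneg zero_le_one]
    intro i
    rw [Real.norm_eq_abs]
    split_ifs with hi
    · rw [abs_mul, abs_of_pos (by positivity), ← h2ρ]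
      exact mul_le_mul_of_nonneg_left (hxi _) (by positivity)
    · rw [abs_mul, abs_of_pos (by positivity), inv_mul_le_iff₀ hlj, mul_one]
      exact hjw _
  · intro x hx
    have hxi : ∀ i, |x i - (K * j + 3 * ρ)| ≤ ρ := fun i => by
      have := (dist_le_pi_dist x _ i).trans (le_of_lt (Metric.mem_ball.1 hx))
      rwa [Real.dist_eq] at this
    have hx0 := abs_le.1 (hxi ⟨0, hd⟩)
    rw [brn_slice N d hd hdN Φ K hK c l y w j x (by rw [abs_le]; constructor <;> linarith), hΦ0,
      mul_zero]
    refine le_trans ?_ (norm_le_pi_norm _ (⟨0, by omega⟩ : Fin N))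
    have hd0 : 0 < d := hd
    simp only [hd0, dif_pos]
    rw [Real.norm_eq_abs, abs_mul, abs_of_pos (by positivity)]
    have h3 : 2 * ρ ≤ |x ⟨0, hd⟩ - K * j| := le_trans (by linarith) (le_abs_self _)
    calc (2 : ℝ) = 2 ^ j * (2 * ρ) := by linarith
      _ ≤ _ := by gcongr

/-- Theorem 1.4 in the critical case `sp = d`: for `0 < p < q ≤ ∞`, `s > σ_p` with
`s p = d`, there exists `f ∈ B^s_{p,q}(ℝ^N)` such that `f(·,y) ∉ BMO(ℝ^d)` for a.e.
`y ∈ ℝ^{N-d}`. -/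
theorem besov_restriction_not_BMO (N d : ℕ) (hN : 2 ≤ N) (hd : 1 ≤ d) (hdN : d < N)
    (p q : ℝ≥0∞) (hp : 0 < p) (hpq : p < q)
    (s : ℝ) (hs : sigmaP N p < s) (hsp : s * p.toReal = d) :
    ∃ f : (Fin N → ℝ) → ℝ, MemBesov N p q s f ∧
      ∀ᵐ y ∂(MeasureTheory.volume : Measure (Fin (N - d) → ℝ)),
        ¬ MemBMO (restrictLast N d f y) := by
  have hpt : p ≠ ⊤ := ne_top_of_lt hpq
  have hP : 0 < p.toReal := ENNReal.toReal_pos hp.ne' hpt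
  obtain ⟨r, hr, hrq⟩ : ∃ r : ℝ, 1 < r ∧ (q ≠ ⊤ → r = q.toReal / p.toReal) := by
    by_cases hq : q = ⊤
    · exact ⟨2, by norm_num, fun h => absurd hq h⟩
    · refine ⟨q.toReal / p.toReal, ?_, fun _ => rfl⟩
      rw [one_lt_div hP]
      exact (ENNReal.toReal_lt_toReal hpt hq).2 hpq
  obtain ⟨c, l, y, hc, hl, ha1, har, hcov⟩ := brn_params (N - d) (by omega) p.toReal r hP hr
  let b : ContDiffBump (0 : Fin N → ℝ) := ⟨1, 2, one_pos, one_lt_two⟩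
  have hb0 : ∀ x : Fin N → ℝ, 2 ≤ ‖x‖ → b x = 0 := fun x hx =>
    b.zero_of_le_dist (by rw [dist_zero_right]; exact hx)
  have hb1 : ∀ x : Fin N → ℝ, ‖x‖ ≤ 1 → b x = 1 := fun x hx =>
    b.one_of_mem_closedBall (by rw [mem_closedBall_zero_iff]; exact hx)
  set K : ℝ := 2 * ((⌊s⌋₊ + 1 : ℕ) : ℝ) + 9 with hK
  have hK0 : (0 : ℝ) ≤ ((⌊s⌋₊ + 1 : ℕ) : ℝ) := Nat.cast_nonneg _
  refine ⟨brnFun N d hdN b K c l y, ?_, Filter.Eventually.of_forall fun w => ?_⟩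
  · exact brn_memBesov N d hd hdN p q hp hpt s hsp b b.contDiff b.hasCompactSupport hb0 K c l y hc
      hl (by linarith) r hr hrq (fun hq => ENNReal.toReal_pos (hp.trans hpq).ne' hq) ha1 har
  · exact brn_notBMO N d hd hdN b hb0 hb1 K (by linarith) c l y hl hcov w
end
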